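/- Consider the continuous crawler model satisfying the regularity conditions on z, B, h, q listed in the context, together with: (C6) q(t,ξ,u) is monotone decreasing in u for every t, ξ, with q(t,ξ,0) = 0, and ∫₀ᵀ (B(s) − ∫_Ω μ⁺(s,ξ) dξ) ds < 0 < ∫₀ᵀ (B(s) + ∫_Ω μ⁻(s,ξ) dξ) ds; and (C7) for almost every t, μ⁺(t,ξ) + μ⁻(t,ξ) > 0 for almost every ξ ∈ Ω. Then the inclusion v̇ ∈ G(t,v) admits exactly one T-periodic solution v*, which is a global attractor: every solution v on an interval [t₀, ∞) satisfies lim_{t→+∞} (v(t) − v*(t)) = 0. -/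

import Mathlib

open MeasureTheory Set Filter Topology
open scoped Classical

/-- Dry-friction part (C3) of the continuous friction density:
`h(t,ξ,u) = {-μ⁺(t,ξ)}` for `u > 0`, `{μ⁻(t,ξ)}` for `u < 0`,
`[-μ⁺(t,ξ), μ⁻(t,ξ)]` for `u = 0`. -/
noncomputable def dryH (μp μm : ℝ → ℝ → ℝ) (t ξ u : ℝ) : Set ℝ :=
  if 0 < u then {-μp t ξ} else if u < 0 then {μm t ξ} else Set.Icc (-μp t ξ) (μm t ξ)

/-- The friction force density `f(t,ξ,u) = h(t,ξ,u) + q(t,ξ,u)`. -/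
noncomputable def fric (μp μm : ℝ → ℝ → ℝ) (q : ℝ → ℝ → ℝ → ℝ) (t ξ u : ℝ) : Set ℝ :=
  {x | ∃ y ∈ dryH μp μm t ξ u, x = y + q t ξ u}

/-- `v` is a solution on `I` of the continuous crawler inclusion
`v̇(t) ∈ G(t,v(t)) = (1/M)(B(t) + ∫_Ω f(t,ξ, v(t) + w(t,ξ)) dξ)`: `v` is locally absolutely
continuous on `I` (primitive of a locally integrable `D`) and, for a.e. `t ∈ I`, there is an
integrable selection `g` of `ξ ↦ f(t,ξ, v(t) + w(t,ξ))` on `Ω` with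
`D t = (B t + ∫_Ω g)/M`. -/
def IsCSolOn (Ω : Set ℝ) (M : ℝ) (B : ℝ → ℝ) (w : ℝ → ℝ → ℝ)
    (f : ℝ → ℝ → ℝ → Set ℝ) (v : ℝ → ℝ) (I : Set ℝ) : Prop :=
  ∃ D : ℝ → ℝ,
    (∀ a ∈ I, ∀ b ∈ I, a ≤ b →
      IntervalIntegrable D volume a b ∧ v b - v a = ∫ s in a..b, D s) ∧
    (∀ᵐ t ∂(volume : Measure ℝ), t ∈ I → ∃ g : ℝ → ℝ,
      IntegrableOn g Ω volume ∧
      (∀ᵐ ξ ∂(volume : Measure ℝ), ξ ∈ Ω → g ξ ∈ f t ξ (v t + w t ξ)) ∧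
      D t = (B t + ∫ ξ in Ω, g ξ) / M)

/-- Regularity assumptions of the continuous crawler model on the body `Ω = [ξa,ξb]`:
mass density `ρ`, total mass `M`, relative position `z` (`T`-periodic in `t`, Lipschitz in
each variable uniformly in the other, with `ρ`-weighted zero average, and a.e. time
derivative `w`), bounded measurable `T`-periodic external force `B`, bounded measurable
nonnegative `T`-periodic dry-friction coefficients `μ±` (C3), and Carathéodory perturbation
`q` locally Lipschitz in `u` uniformly in `(t,ξ)` (C4). -/
def ContCrawlerModel (T ξa ξb : ℝ) (ρ : ℝ → ℝ) (M : ℝ) (z w : ℝ → ℝ → ℝ)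
    (B : ℝ → ℝ) (μp μm : ℝ → ℝ → ℝ) (q : ℝ → ℝ → ℝ → ℝ) : Prop :=
  ξa < ξb ∧
  Measurable ρ ∧ (∀ ξ, 0 ≤ ρ ξ) ∧ (∃ C, ∀ ξ, ρ ξ ≤ C) ∧
  M = (∫ ξ in Set.Icc ξa ξb, ρ ξ) ∧ 0 < M ∧
  (∀ ξ, Function.Periodic (fun t => z t ξ) T) ∧
  (∃ L : NNReal, ∀ ξ ∈ Set.Icc ξa ξb, LipschitzWith L (fun t => z t ξ)) ∧
  (∃ L : NNReal, ∀ t, LipschitzOnWith L (fun ξ => z t ξ) (Set.Icc ξa ξb)) ∧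
  (∀ t, (∫ ξ in Set.Icc ξa ξb, z t ξ * ρ ξ) = 0) ∧
  (∀ ξ ∈ Set.Icc ξa ξb, ∀ᵐ t ∂(volume : Measure ℝ),
    HasDerivAt (fun s => z s ξ) (w t ξ) t) ∧
  Measurable B ∧ (∃ C, ∀ t, |B t| ≤ C) ∧ Function.Periodic B T ∧
  Measurable (Function.uncurry μp) ∧ Measurable (Function.uncurry μm) ∧
  (∀ t ξ, 0 ≤ μp t ξ ∧ 0 ≤ μm t ξ) ∧
  (∃ C, ∀ t ξ, μp t ξ ≤ C ∧ μm t ξ ≤ C) ∧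
  (∀ ξ, Function.Periodic (fun t => μp t ξ) T ∧ Function.Periodic (fun t => μm t ξ) T) ∧
  (∀ r : ℝ, 0 < r → ∃ L : ℝ, ∀ t ξ u₁ u₂, |u₁| ≤ r → |u₂| ≤ r →
    |q t ξ u₁ - q t ξ u₂| ≤ L * |u₁ - u₂|) ∧
  (∀ u, Measurable (fun s : ℝ × ℝ => q s.1 s.2 u) ∧ (∃ C, ∀ t ξ, |q t ξ u| ≤ C) ∧
    ∀ ξ, Function.Periodic (fun t => q t ξ u) T)

/-- Dissipativity condition (C5) for the continuous crawler: every admissible value of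
`∫_Ω f(t,ξ,u) dξ` is `≥ -ℓ⁻(t)` for `u ≤ -R` and `≤ ℓ⁺(t)` for `u ≥ R`, with
`∫₀ᵀ (B - ℓ⁺) < 0 < ∫₀ᵀ (B + ℓ⁻)`. -/
def CondC5 (T ξa ξb : ℝ) (B : ℝ → ℝ) (μp μm : ℝ → ℝ → ℝ) (q : ℝ → ℝ → ℝ → ℝ) : Prop :=
  ∃ (R : ℝ) (ℓm ℓp : ℝ → ℝ), 0 < R ∧
    Measurable ℓm ∧ Measurable ℓp ∧
    Function.Periodic ℓm T ∧ Function.Periodic ℓp T ∧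
    (∀ t, ∀ u ≤ -R, ∀ g : ℝ → ℝ, IntegrableOn g (Set.Icc ξa ξb) volume →
      (∀ᵐ ξ ∂(volume : Measure ℝ), ξ ∈ Set.Icc ξa ξb → g ξ ∈ fric μp μm q t ξ u) →
      -ℓm t ≤ ∫ ξ in Set.Icc ξa ξb, g ξ) ∧
    (∀ t, ∀ u, R ≤ u → ∀ g : ℝ → ℝ, IntegrableOn g (Set.Icc ξa ξb) volume →
      (∀ᵐ ξ ∂(volume : Measure ℝ), ξ ∈ Set.Icc ξa ξb → g ξ ∈ fric μp μm q t ξ u) →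
      (∫ ξ in Set.Icc ξa ξb, g ξ) ≤ ℓp t) ∧
    (∫ s in (0:ℝ)..T, (B s - ℓp s)) < 0 ∧ 0 < ∫ s in (0:ℝ)..T, (B s + ℓm s)

/-- `v` is a primitive of the locally integrable function `D` on `I`. -/
def IsPrimitiveOn (v D : ℝ → ℝ) (I : Set ℝ) : Prop :=
  ∀ a ∈ I, ∀ b ∈ I, a ≤ b → IntervalIntegrable D volume a b ∧ v b - v a = ∫ s in a..b, D s

theorem IsPrimitiveOn.mono {v D : ℝ → ℝ} {I J : Set ℝ} (h : IsPrimitiveOn v D I) (hJ : J ⊆ I) :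
    IsPrimitiveOn v D J :=
  fun a ha b hb hab => h a (hJ ha) b (hJ hb) hab

theorem IsPrimitiveOn.sub {v D u E : ℝ → ℝ} {I : Set ℝ} (h : IsPrimitiveOn v D I)
    (h' : IsPrimitiveOn u E I) : IsPrimitiveOn (fun t => v t - u t) (fun t => D t - E t) I := by
  intro a ha b hb hab
  obtain ⟨h1, h2⟩ := h a ha b hb hab
  obtain ⟨h3, h4⟩ := h' a ha b hb hab
  refine ⟨h1.sub h3, ?_⟩
  rw [intervalIntegral.integral_sub h1 h3, ← h2, ← h4]
  ring

theorem IsPrimitiveOn.neg {v D : ℝ → ℝ} {I : Set ℝ} (h : IsPrimitiveOn v D I) :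
    IsPrimitiveOn (fun t => -v t) (fun t => -D t) I := by
  intro a ha b hb hab
  obtain ⟨h1, h2⟩ := h a ha b hb hab
  refine ⟨h1.neg, ?_⟩
  rw [intervalIntegral.integral_neg, ← h2]
  ring

theorem isPrimitiveOn_const_add_mul (k c : ℝ) (I : Set ℝ) :
    IsPrimitiveOn (fun t => k + c * t) (fun _ => c) I := by
  intro a _ b _ _
  refine ⟨intervalIntegrable_const, ?_⟩
  rw [intervalIntegral.integral_const, smul_eq_mul]
  ring

theorem IsPrimitiveOn.continuousOn_Icc {v D : ℝ → ℝ} {a b : ℝ}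
    (h : IsPrimitiveOn v D (Icc a b)) : ContinuousOn v (Icc a b) := by
  rcases lt_or_ge b a with hab | hab
  · simp [Icc_eq_empty_of_lt hab]
  have hi := (h a (left_mem_Icc.2 hab) b (right_mem_Icc.2 hab) hab).1
  have hc : ContinuousOn (fun t => v a + ∫ s in a..t, D s) (Icc a b) := by
    refine continuousOn_const.add ?_
    have := intervalIntegral.continuousOn_primitive_interval' hi left_mem_uIcc
    rwa [uIcc_of_le hab] at this
  refine hc.congr fun t ht => ?_
  have := (h a (left_mem_Icc.2 hab) t ht ht.1).2
  simp only
  linarith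

theorem IsPrimitiveOn.continuous {v D : ℝ → ℝ} (h : IsPrimitiveOn v D univ) : Continuous v := by
  rw [continuous_iff_continuousAt]
  intro t
  exact ((h.mono (subset_univ (Icc (t - 1) (t + 1)))).continuousOn_Icc).continuousAt
    (Icc_mem_nhds (by linarith) (by linarith))

theorem intervalIntegral_mono_of_ae_Ioc {D E : ℝ → ℝ} {a b : ℝ} (hab : a ≤ b)
    (hD : IntervalIntegrable D volume a b) (hE : IntervalIntegrable E volume a b)
    (h : ∀ᵐ t ∂(volume : Measure ℝ), t ∈ Ioc a b → D t ≤ E t) :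
    ∫ s in a..b, D s ≤ ∫ s in a..b, E s := by
  rw [intervalIntegral.integral_of_le hab, intervalIntegral.integral_of_le hab]
  exact setIntegral_mono_on_ae ((intervalIntegrable_iff_integrableOn_Ioc_of_le hab).1 hD)
    ((intervalIntegrable_iff_integrableOn_Ioc_of_le hab).1 hE) measurableSet_Ioc h

/-- The positive part of an absolutely continuous function whose derivative is nonpositive
wherever the function is positive does not increase. -/
theorem IsPrimitiveOn.le_max_zero {e E : ℝ → ℝ} {a b : ℝ} (hab : a ≤ b)
    (h : IsPrimitiveOn e E (Icc a b))
    (hE : ∀ᵐ t ∂(volume : Measure ℝ), t ∈ Ioc a b → 0 < e t → E t ≤ 0) :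
    e b ≤ max (e a) 0 := by
  by_contra! hlt
  set m := max (e a) 0 with hm
  have hc := h.continuousOn_Icc
  let S := Icc a b ∩ e ⁻¹' Iic m
  have hS : IsCompact S :=
    isCompact_Icc.of_isClosed_subset (hc.preimage_isClosed_of_isClosed isClosed_Icc isClosed_Iic)
      inter_subset_left
  have hne : S.Nonempty := ⟨a, left_mem_Icc.2 hab, le_max_left (e a) 0⟩
  have hs := hS.sSup_mem hne
  set s := sSup S
  have hpos : ∀ t ∈ Ioc s b, 0 < e t := by
    intro t ht
    by_contra! hle
    have : t ∈ S := ⟨⟨hs.1.1.trans ht.1.le, ht.2⟩, hle.trans (le_max_right _ _)⟩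
    exact absurd (le_csSup hS.bddAbove this) (not_le.2 ht.1)
  obtain ⟨hi, heq⟩ := h s hs.1 b (right_mem_Icc.2 hab) hs.1.2
  have h_int : ∫ r in s..b, E r ≤ ∫ r in s..b, (0 : ℝ) := by
    refine intervalIntegral_mono_of_ae_Ioc hs.1.2 hi intervalIntegrable_const ?_
    filter_upwards [hE] with t ht htm
    exact ht ⟨hs.1.1.trans_lt htm.1, htm.2⟩ (hpos t htm)
  rw [intervalIntegral.integral_zero] at h_int
  have := hs.2
  simp only [mem_preimage, mem_Iic] at this
  linarith

theorem IsPrimitiveOn.le_max_zero_add {e E : ℝ → ℝ} {a b c : ℝ} (hab : a ≤ b) (hc : 0 ≤ c)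
    (h : IsPrimitiveOn e E (Icc a b))
    (hE : ∀ᵐ t ∂(volume : Measure ℝ), t ∈ Ioc a b → 0 < e t → E t ≤ c) :
    e b ≤ max (e a) 0 + c * (b - a) := by
  have := (h.sub (isPrimitiveOn_const_add_mul (-(c * a)) c _)).le_max_zero hab (by
    filter_upwards [hE] with t ht htm hpos
    have h1 : 0 ≤ c * (t - a) := mul_nonneg hc (sub_nonneg.2 htm.1.le)
    linarith [ht htm (by nlinarith)])
  have h2 : e a - (-(c * a) + c * a) = e a := by ring
  rw [h2] at this
  linarith

theorem abs_intervalIntegral_le {D : ℝ → ℝ} {C : ℝ} (hC : ∀ t, |D t| ≤ C) (a b : ℝ) :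
    |∫ s in a..b, D s| ≤ C * |b - a| := by
  rw [← Real.norm_eq_abs]
  exact intervalIntegral.norm_integral_le_of_norm_le_const fun s _ => hC s

/-- Values of the explicit Euler scheme with step `δ` for `v' = G(t, v)`. -/
noncomputable def eulerSeq (G : ℝ → ℝ → ℝ) (δ x : ℝ) : ℕ → ℝ
  | 0 => x
  | k + 1 => eulerSeq G δ x k + ∫ s in (k * δ)..((k + 1 : ℕ) * δ), G s (eulerSeq G δ x k)

theorem exists_euler_approx {G : ℝ → ℝ → ℝ} (hmeas : ∀ x, Measurable fun t => G t x) {C : ℝ}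
    (hC : ∀ t x, |G t x| ≤ C) (x₀ : ℝ) {δ : ℝ} (hδ : 0 < δ) :
    ∃ v y : ℝ → ℝ, v 0 = x₀ ∧
      (∀ a b, IntervalIntegrable (fun t => G t (y t)) volume a b ∧
        v b - v a = ∫ s in a..b, G s (y s)) ∧
      ∀ t, 0 ≤ t → |v t - y t| ≤ C * δ := by
  set X := eulerSeq G δ x₀ with hX
  let y : ℝ → ℝ := fun t => X ⌊t / δ⌋₊
  have hm : Measurable fun t => G t (y t) := by
    have h1 : Measurable fun p : ℝ × ℕ => G p.1 (X p.2) :=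
      measurable_from_prod_countable_left fun k => hmeas (X k)
    have h2 : Measurable fun t : ℝ => (t, ⌊t / δ⌋₊) :=
      measurable_id.prodMk (Nat.measurable_floor.comp (measurable_id.div_const δ))
    exact h1.comp h2
  have hi : ∀ a b, IntervalIntegrable (fun t => G t (y t)) volume a b := by
    intro a b
    refine (intervalIntegrable_const (c := C)).mono_fun hm.aestronglyMeasurable ?_
    exact ae_of_all _ fun t => (hC t (y t)).trans (le_abs_self C)
  let v : ℝ → ℝ := fun t => x₀ + ∫ s in (0 : ℝ)..t, G s (y s)
  have hv : ∀ a b, v b - v a = ∫ s in a..b, G s (y s) := by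
    intro a b
    have := intervalIntegral.integral_add_adjacent_intervals (hi 0 a) (hi a b)
    simp only [v]
    linarith
  have hnode : ∀ k : ℕ, v (k * δ) = X k := by
    intro k
    induction k with
    | zero => simp [v, hX, eulerSeq]
    | succ k ih =>
      have h1 := hv (k * δ) ((k + 1 : ℕ) * δ)
      have hle : (k : ℝ) * δ ≤ ((k + 1 : ℕ) : ℝ) * δ := by
        push_cast
        nlinarith
      have h2 : ∫ s in (k * δ)..((k + 1 : ℕ) * δ), G s (y s)
          = ∫ s in (k * δ)..((k + 1 : ℕ) * δ), G s (X k) := by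
        rw [intervalIntegral.integral_of_le hle, intervalIntegral.integral_of_le hle,
          integral_Ioc_eq_integral_Ioo, integral_Ioc_eq_integral_Ioo]
        refine setIntegral_congr_fun measurableSet_Ioo fun s hs => ?_
        have : ⌊s / δ⌋₊ = k := by
          rw [Nat.floor_eq_iff (div_nonneg ((by positivity : (0 : ℝ) ≤ k * δ).trans hs.1.le) hδ.le),
            le_div_iff₀ hδ, div_lt_iff₀ hδ]
          have := hs.2
          push_cast at this
          exact ⟨hs.1.le, this⟩
        simp only [y, this]
      have h3 : X (k + 1) = X k + ∫ s in (k * δ)..((k + 1 : ℕ) * δ), G s (X k) := rfl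
      rw [h3, ← h2, ← h1, ih]
      ring
  refine ⟨v, y, by simp [v], fun a b => ⟨hi a b, hv a b⟩, fun t ht => ?_⟩
  have hfl : (⌊t / δ⌋₊ : ℝ) * δ ≤ t := by
    rw [← le_div_iff₀ hδ]
    exact Nat.floor_le (div_nonneg ht hδ.le)
  have hfl' : t < (⌊t / δ⌋₊ + 1 : ℝ) * δ := by
    rw [← div_lt_iff₀ hδ]
    exact Nat.lt_floor_add_one _
  have hC0 : 0 ≤ C := (abs_nonneg _).trans (hC 0 0)
  have h1 : |v t - v (⌊t / δ⌋₊ * δ)| ≤ C * |t - ⌊t / δ⌋₊ * δ| := by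
    rw [hv]
    exact abs_intervalIntegral_le (fun s => hC s (y s)) _ _
  rw [hnode] at h1
  refine h1.trans (mul_le_mul_of_nonneg_left ?_ hC0)
  rw [abs_of_nonneg (by linarith)]
  linarith

theorem intervalIntegrable_of_abs_le {D : ℝ → ℝ} (hm : Measurable D) {C : ℝ}
    (hC : ∀ t, |D t| ≤ C) (a b : ℝ) : IntervalIntegrable D volume a b :=
  (intervalIntegrable_const (c := C)).mono_fun hm.aestronglyMeasurable
    (ae_of_all _ fun t => (hC t).trans (le_abs_self C))

theorem le_deriv_of_tendsto_approx {G : ℝ → ℝ → ℝ} (hanti : ∀ t, Antitone (G t))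
    (hmeas : ∀ x, Measurable fun t => G t x) {C : ℝ} (hC : ∀ t x, |G t x| ≤ C)
    {v : ℝ → ℝ} (hv : Continuous v) (hd : ∀ᵐ t ∂(volume : Measure ℝ), DifferentiableAt ℝ v t)
    {V Y : ℕ → ℝ → ℝ} {ε : ℕ → ℝ} (hε : Tendsto ε atTop (𝓝 0))
    (hV : ∀ n t, 0 ≤ t → |V n t - v t| ≤ ε n) (hY : ∀ n t, 0 ≤ t → |Y n t - v t| ≤ ε n)
    (hprim : ∀ n, IsPrimitiveOn (V n) (fun t => G t (Y n t)) (Ici 0)) :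
    ∀ᵐ t ∂(volume : Measure ℝ), 0 < t → ∀ x, v t < x → G t x ≤ deriv v t := by
  have h_int : ∀ x a b, IntervalIntegrable (fun t => G t x) volume a b := fun x a b =>
    intervalIntegrable_of_abs_le (hmeas x) (fun t => hC t x) a b
  have key : ∀ x a b, 0 ≤ a → a ≤ b → (∀ s ∈ Icc a b, v s < x) →
      ∫ s in a..b, G s x ≤ v b - v a := by
    intro x a b ha hab hlt
    obtain ⟨s₀, hs₀, hmax⟩ := isCompact_Icc.exists_isMaxOn (nonempty_Icc.2 hab) hv.continuousOn
    have hη : 0 < x - v s₀ := sub_pos.2 (hlt s₀ hs₀)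
    have hlim : ∀ t, 0 ≤ t → Tendsto (fun n => V n t) atTop (𝓝 (v t)) := by
      intro t ht
      rw [tendsto_iff_dist_tendsto_zero]
      exact squeeze_zero (fun _ => dist_nonneg) (fun n => hV n t ht) hε
    refine ge_of_tendsto ((hlim b (ha.trans hab)).sub (hlim a ha)) ?_
    filter_upwards [hε.eventually (gt_mem_nhds hη)] with n hn
    obtain ⟨h1, h2⟩ := hprim n a ha b (ha.trans hab) hab
    rw [h2]
    refine intervalIntegral_mono_of_ae_Ioc hab (h_int x a b) h1 (ae_of_all _ fun s hs => ?_)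
    refine hanti s ?_
    have h3 := abs_le.1 (hY n s (ha.trans hs.1.le))
    have h4 : v s ≤ v s₀ := hmax (Ioc_subset_Icc_self hs)
    linarith [h3.2]
  have hder : ∀ᵐ t ∂(volume : Measure ℝ), ∀ r : ℚ,
      HasDerivAt (fun s => ∫ u in (0 : ℝ)..s, G u r) (G t r) t := by
    rw [ae_all_iff]
    intro r
    have hloc : LocallyIntegrable (fun t => G t r) volume := by
      refine (locallyIntegrable_const C).mono (hmeas r).aestronglyMeasurable ?_
      exact ae_of_all _ fun t => (hC t r).trans (le_abs_self C)
    filter_upwards [LocallyIntegrable.ae_hasDerivAt_integral hloc] with t ht using ht 0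
  filter_upwards [hd, hder] with t htd htr ht0 x hx
  obtain ⟨r, hr1, hr2⟩ := exists_rat_btwn hx
  refine (hanti t hr2.le).trans ?_
  have hdd := htd.hasDerivAt.sub (htr r)
  have hslope := hdd.tendsto_slope_zero_right
  refine sub_nonneg.1 (ge_of_tendsto hslope ?_)
  have hev : ∀ᶠ s in 𝓝 t, v s < r := hv.continuousAt.eventually (gt_mem_nhds hr1)
  obtain ⟨η, hη, hball⟩ := Metric.eventually_nhds_iff.1 hev
  filter_upwards [Ioo_mem_nhdsGT hη] with h hh
  have h1 := key r t (t + h) ht0.le (by linarith [hh.1]) (by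
    intro s hs
    refine hball ?_
    rw [Real.dist_eq, abs_of_nonneg (by linarith [hs.1])]
    linarith [hs.2, hh.2])
  have h2 := intervalIntegral.integral_add_adjacent_intervals (h_int r 0 t) (h_int r t (t + h))
  refine smul_nonneg (inv_nonneg.2 hh.1.le) ?_
  simp only [Pi.sub_apply]
  linarith

/-- Forward existence for the scalar inclusion `v' ∈ [G(t, v+), G(t, v-)]` with `G` bounded and
antitone in the state. -/
theorem exists_solution_of_antitone {G : ℝ → ℝ → ℝ} (hanti : ∀ t, Antitone (G t))
    (hmeas : ∀ x, Measurable fun t => G t x) {C : ℝ} (hC : ∀ t x, |G t x| ≤ C) (x₀ : ℝ) :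
    ∃ v D : ℝ → ℝ, v 0 = x₀ ∧ IsPrimitiveOn v D univ ∧
      ∀ᵐ t ∂(volume : Measure ℝ), 0 < t → ∀ x, (v t < x → G t x ≤ D t) ∧
        (x < v t → D t ≤ G t x) := by
  have hC0 : 0 ≤ C := (abs_nonneg _).trans (hC 0 0)
  let δ : ℕ → ℝ := fun n => 1 / ((n : ℝ) + 1)
  have hδ : ∀ n, 0 < δ n := fun n => by positivity
  have hδlim : Tendsto δ atTop (𝓝 0) := tendsto_one_div_add_atTop_nhds_zero_nat
  choose V Y hV0 hVp hVY using fun n => exists_euler_approx hmeas hC x₀ (hδ n)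
  have hprim : ∀ n, IsPrimitiveOn (V n) (fun t => G t (Y n t)) (Ici 0) :=
    fun n a _ b _ _ => hVp n a b
  have hcmp : ∀ n m t, 0 ≤ t → V n t - V m t ≤ C * δ n + C * δ m := by
    intro n m t ht
    have h1 := (((hprim n).sub (hprim m)).sub
      (isPrimitiveOn_const_add_mul (C * δ n + C * δ m) 0 (Ici 0))).mono
        (Icc_subset_Ici_self (a := t) (b := 0))
    have h2 := h1.le_max_zero ht (ae_of_all _ fun s hs hpos => by
      have h3 := abs_le.1 (hVY n s hs.1.le)
      have h4 := abs_le.1 (hVY m s hs.1.le)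
      have h5 : Y m s ≤ Y n s := by linarith
      linarith [hanti s h5])
    have h3 : max (V n 0 - V m 0 - (C * δ n + C * δ m + 0 * 0)) 0 = 0 := by
      refine max_eq_right ?_
      rw [hV0, hV0]
      have := mul_nonneg hC0 (hδ n).le
      have := mul_nonneg hC0 (hδ m).le
      linarith
    rw [h3] at h2
    linarith
  have habs : ∀ n m t, 0 ≤ t → |V n t - V m t| ≤ C * δ n + C * δ m := fun n m t ht =>
    abs_le.2 ⟨by linarith [hcmp m n t ht], hcmp n m t ht⟩
  have hcau : ∀ t, ∃ l, Tendsto (fun n => V n (max t 0)) atTop (𝓝 l) := by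
    intro t
    refine cauchySeq_tendsto_of_complete
      (cauchySeq_of_le_tendsto_0 (fun N => C * δ N + C * δ N) (fun n m N hn hm => ?_) ?_)
    · refine (habs n m _ (le_max_right _ _)).trans ?_
      have h1 : δ n ≤ δ N := Nat.one_div_le_one_div hn
      have h2 : δ m ≤ δ N := Nat.one_div_le_one_div hm
      nlinarith
    · simpa using (hδlim.const_mul C).add (hδlim.const_mul C)
  choose v hv using hcau
  have hv' : ∀ t, 0 ≤ t → Tendsto (fun n => V n t) atTop (𝓝 (v t)) := by
    intro t ht
    have := hv t
    rwa [max_eq_left ht] at this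
  have hVv : ∀ n t, 0 ≤ t → |V n t - v t| ≤ C * δ n := by
    intro n t ht
    have h1 : Tendsto (fun m => |V n t - V m t|) atTop (𝓝 |V n t - v t|) :=
      (tendsto_const_nhds.sub (hv' t ht)).abs
    have h2 : Tendsto (fun m => C * δ n + C * δ m) atTop (𝓝 (C * δ n)) := by
      simpa using (hδlim.const_mul C).const_add (C * δ n)
    exact le_of_tendsto_of_tendsto' h1 h2 fun m => habs n m t ht
  have hlip : LipschitzWith C.toNNReal v := by
    refine LipschitzWith.of_dist_le_mul fun a b => ?_
    refine le_of_tendsto ((hv a).dist (hv b)) (Eventually.of_forall fun n => ?_)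
    rw [Real.coe_toNNReal _ hC0, dist_comm, Real.dist_eq, (hVp n _ _).2]
    refine (abs_intervalIntegral_le (fun s => hC s (Y n s)) _ _).trans (mul_le_mul_of_nonneg_left ?_ hC0)
    rw [dist_comm, Real.dist_eq]
    exact abs_max_sub_max_le_abs _ _ _
  have hdiff := hlip.ae_differentiableAt_real
  have hYv : ∀ n t, 0 ≤ t → |Y n t - v t| ≤ 2 * C * δ n := by
    intro n t ht
    have h3 := abs_le.1 (hVY n t ht)
    have h4 := abs_le.1 (hVv n t ht)
    exact abs_le.2 ⟨by linarith, by linarith⟩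
  have hVv' : ∀ n t, 0 ≤ t → |V n t - v t| ≤ 2 * C * δ n := fun n t ht =>
    (hVv n t ht).trans (by nlinarith [hδ n])
  have hε : Tendsto (fun n => 2 * C * δ n) atTop (𝓝 0) := by
    simpa using hδlim.const_mul (2 * C)
  refine ⟨v, deriv v, ?_, ?_, ?_⟩
  · have h1 := hv' 0 le_rfl
    simp only [hV0] at h1
    exact tendsto_nhds_unique h1 tendsto_const_nhds
  · intro a _ b _ hab
    have hac : AbsolutelyContinuousOnInterval v a b :=
      (hlip.lipschitzOnWith (s := uIcc a b)).absolutelyContinuousOnInterval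
    exact ⟨hac.intervalIntegrable_deriv, hac.integral_deriv_eq_sub.symm⟩
  · have h1 := le_deriv_of_tendsto_approx hanti hmeas hC hlip.continuous hdiff hε hVv' hYv hprim
    have h2 := le_deriv_of_tendsto_approx (G := fun t x => -G t (-x))
      (fun t x y hxy => neg_le_neg (hanti t (neg_le_neg hxy))) (fun x => (hmeas (-x)).neg)
      (C := C) (fun t x => by rw [abs_neg]; exact hC t (-x)) (v := fun t => -v t)
      hlip.continuous.neg (hdiff.mono fun t ht => ht.neg) (V := fun n t => -V n t)
      (Y := fun n t => -Y n t) hε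
      (fun n t ht => by
        rw [← neg_sub', abs_neg]
        exact hVv' n t ht)
      (fun n t ht => by
        rw [← neg_sub', abs_neg]
        exact hYv n t ht)
      (fun n => by simpa using (hprim n).neg)
    filter_upwards [h1, h2] with t h1 h2 ht x
    refine ⟨h1 ht x, fun hx => ?_⟩
    have h3 := h2 ht (-x) (neg_lt_neg hx)
    rw [neg_neg, deriv.fun_neg] at h3
    linarith

theorem ae_of_periodic_of_ae_Ioo {Q : ℝ → Prop} {T : ℝ} (hT : 0 < T)
    (hQ : Function.Periodic Q T) {a : ℝ}
    (h : ∀ᵐ t ∂(volume : Measure ℝ), t ∈ Ioo a (a + T) → Q t) :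
    ∀ᵐ t ∂(volume : Measure ℝ), Q t := by
  have hne : ∀ᵐ t ∂(volume : Measure ℝ), t ≠ a := by simp [ae_iff]
  have h' : ∀ᵐ t ∂(volume : Measure ℝ), t ∈ Ico a (a + T) → Q t := by
    filter_upwards [h, hne] with t ht hta hm
    exact ht ⟨lt_of_le_of_ne hm.1 hta.symm, hm.2⟩
  have hshift : ∀ᵐ t ∂(volume : Measure ℝ), ∀ k : ℤ, t + k • T ∈ Ico a (a + T) →
      Q (t + k • T) := by
    rw [ae_all_iff]
    intro k
    exact (measurePreserving_add_right volume (k • T)).quasiMeasurePreserving.ae h'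
  filter_upwards [hshift] with t ht
  obtain ⟨k, hk, -⟩ := existsUnique_add_zsmul_mem_Ico hT t a
  have h1 := ht k hk
  rwa [hQ.zsmul k t] at h1

theorem IsPrimitiveOn.apply_le_of_dissipative {v D β : ℝ → ℝ} {T L C : ℝ} (hT : 0 < T)
    (hp : IsPrimitiveOn v D (Icc 0 T)) (hC : 0 ≤ C) (hβC : ∀ t, β t ≤ C)
    (hβi : IntervalIntegrable β volume 0 T) (hβ : ∫ s in (0 : ℝ)..T, β s ≤ 0)
    (h : ∀ᵐ t ∂(volume : Measure ℝ), 0 < t → L < v t → D t ≤ β t) (h0 : v 0 = L + C * T) :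
    v T ≤ v 0 := by
  have hz : (0 : ℝ) ∈ Icc 0 T := left_mem_Icc.2 hT.le
  have hTm : T ∈ Icc 0 T := right_mem_Icc.2 hT.le
  by_cases hall : ∀ t ∈ Icc 0 T, L < v t
  · obtain ⟨h1, h2⟩ := hp 0 hz T hTm hT.le
    have h3 : ∫ s in (0 : ℝ)..T, D s ≤ ∫ s in (0 : ℝ)..T, β s := by
      refine intervalIntegral_mono_of_ae_Ioc hT.le h1 hβi ?_
      filter_upwards [h] with t ht htm
      exact ht htm.1 (hall t ⟨htm.1.le, htm.2⟩)
    linarith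
  · push Not at hall
    obtain ⟨s, hs, hvs⟩ := hall
    have hp' := ((hp.sub (isPrimitiveOn_const_add_mul L 0 _)).mono
      (Icc_subset_Icc_left hs.1)).le_max_zero_add hs.2 hC (by
        filter_upwards [h] with t ht htm hpos
        linarith [ht (hs.1.trans_lt htm.1) (by linarith), hβC t])
    rw [max_eq_right (by linarith)] at hp'
    have : C * (T - s) ≤ C * T := mul_le_mul_of_nonneg_left (by linarith [hs.1]) hC
    linarith

theorem exists_periodic_solution_of_bounded {G : ℝ → ℝ → ℝ} {T : ℝ} (hT : 0 < T)
    (hanti : ∀ t, Antitone (G t)) (hmeas : ∀ x, Measurable fun t => G t x)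
    (hper : ∀ x, Function.Periodic (fun t => G t x) T) {C₀ : ℝ} (hC₀ : ∀ t x, |G t x| ≤ C₀)
    {L C : ℝ} (hL : 0 ≤ L) (hC : 0 ≤ C) {βp βm : ℝ → ℝ}
    (hβp : ∀ t x, L < x → G t x ≤ βp t) (hβm : ∀ t x, x < -L → βm t ≤ G t x)
    (hβpC : ∀ t, βp t ≤ C) (hβmC : ∀ t, -C ≤ βm t)
    (hβpi : IntervalIntegrable βp volume 0 T) (hβmi : IntervalIntegrable βm volume 0 T)
    (hp : ∫ s in (0 : ℝ)..T, βp s ≤ 0) (hm : 0 ≤ ∫ s in (0 : ℝ)..T, βm s) :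
    ∃ v D : ℝ → ℝ, Function.Periodic v T ∧ IsPrimitiveOn v D univ ∧
      (∀ᵐ t ∂(volume : Measure ℝ), ∀ x, (v t < x → G t x ≤ D t) ∧ (x < v t → D t ≤ G t x)) ∧
      ∀ t, |v t| ≤ L + 2 * C * T := by
  choose V D hV0 hVp hVG using fun x₀ => exists_solution_of_antitone hanti hmeas hC₀ x₀
  have hup : ∀ x, ∀ᵐ t ∂(volume : Measure ℝ), 0 < t → L < V x t → D x t ≤ βp t := by
    intro x
    filter_upwards [hVG x] with t ht h0 hlt
    obtain ⟨y, hy1, hy2⟩ := exists_between hlt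
    exact ((ht h0 y).2 hy2).trans (hβp t y hy1)
  have hlo : ∀ x, ∀ᵐ t ∂(volume : Measure ℝ), 0 < t → L < -V x t → -D x t ≤ -βm t := by
    intro x
    filter_upwards [hVG x] with t ht h0 hlt
    obtain ⟨y, hy1, hy2⟩ := exists_between (lt_neg.1 hlt)
    exact neg_le_neg ((hβm t y hy2).trans ((ht h0 y).1 hy1))
  have hcmp : ∀ x y, V x T - V y T ≤ |x - y| := by
    intro x y
    have h1 := (((hVp x).sub (hVp y)).mono (subset_univ (Icc 0 T))).le_max_zero hT.le (by
      filter_upwards [hVG x, hVG y] with t htx hty htm hpos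
      obtain ⟨z, hz1, hz2⟩ := exists_between (sub_pos.1 hpos)
      exact sub_nonpos.2 (((htx htm.1 z).2 hz2).trans ((hty htm.1 z).1 hz1)))
    rw [hV0, hV0] at h1
    exact h1.trans (max_le (le_abs_self _) (abs_nonneg _))
  have hPc : Continuous fun x => V x T := by
    refine LipschitzWith.continuous (K := 1) (LipschitzWith.of_dist_le_mul fun x y => ?_)
    rw [NNReal.coe_one, one_mul, Real.dist_eq, Real.dist_eq]
    refine abs_le.2 ⟨?_, hcmp x y⟩
    have := hcmp y x
    rw [abs_sub_comm] at this
    linarith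
  set K := L + C * T with hK
  have hCT : 0 ≤ C * T := mul_nonneg hC hT.le
  have hPK : V K T - K ≤ 0 := by
    have := ((hVp K).mono (subset_univ _)).apply_le_of_dissipative hT hC hβpC hβpi hp (hup K)
      (hV0 K)
    rw [hV0] at this
    linarith
  have hPK' : 0 ≤ V (-K) T - -K := by
    have := ((hVp (-K)).neg.mono (subset_univ _)).apply_le_of_dissipative hT hC
      (fun t => neg_le.1 (hβmC t)) hβmi.neg
      (by simpa [intervalIntegral.integral_neg] using hm) (hlo (-K)) (by rw [hV0, neg_neg])
    rw [hV0] at this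
    linarith
  obtain ⟨x, hxK, hx⟩ := intermediate_value_Icc' (f := fun x => V x T - x)
    (by linarith : -K ≤ K) (hPc.sub continuous_id).continuousOn ⟨hPK, hPK'⟩
  have hfix : V x T = V x 0 := by rw [hV0]; exact sub_eq_zero.1 hx
  let E : ℝ → ℝ := fun t => D x (toIocMod hT 0 t)
  have hEper : Function.Periodic E T := fun t => by simp [E]
  have hEeq : ∀ t ∈ Ioc 0 T, E t = D x t := by
    intro t ht
    have : toIocMod hT 0 t = t := (toIocMod_eq_self hT).2 (by simpa using ht)
    simp only [E, this]
  have hEint0 : ∀ t ∈ Icc 0 T, IntervalIntegrable E volume 0 t ∧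
      ∫ s in (0 : ℝ)..t, E s = V x t - V x 0 := by
    intro t ht
    obtain ⟨h1, h2⟩ := hVp x 0 trivial t trivial ht.1
    have heq : EqOn (D x) E (uIoc 0 t) := by
      rw [uIoc_of_le ht.1]
      exact fun s hs => (hEeq s ⟨hs.1, hs.2.trans ht.2⟩).symm
    refine ⟨h1.congr heq, ?_⟩
    rw [h2]
    exact (intervalIntegral.integral_congr_ae (ae_of_all _ fun s hs => heq hs)).symm
  have hEint : ∀ a b, IntervalIntegrable E volume a b := by
    have h1 := (hEint0 T (right_mem_Icc.2 hT.le)).1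
    exact hEper.intervalIntegrable hT.ne' (t := 0) (by rwa [zero_add])
  let u : ℝ → ℝ := fun t => x + ∫ s in (0 : ℝ)..t, E s
  have hu : ∀ a b, u b - u a = ∫ s in a..b, E s := by
    intro a b
    have := intervalIntegral.integral_add_adjacent_intervals (hEint 0 a) (hEint a b)
    simp only [u]
    linarith
  have huper : Function.Periodic u T := by
    intro t
    have h1 := hu t (t + T)
    rw [hEper.intervalIntegral_add_eq t 0, zero_add, (hEint0 T (right_mem_Icc.2 hT.le)).2,
      hfix] at h1
    linarith
  have huV : ∀ t ∈ Icc 0 T, u t = V x t := by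
    intro t ht
    simp only [u]
    rw [(hEint0 t ht).2, hV0]
    ring
  have hbound : ∀ t ∈ Icc 0 T, |u t| ≤ L + 2 * C * T := by
    intro t ht
    have hCt : C * (t - 0) ≤ C * T := mul_le_mul_of_nonneg_left (by linarith [ht.2]) hC
    have h1 := (((hVp x).sub (isPrimitiveOn_const_add_mul L 0 _)).mono
      (subset_univ (Icc 0 t))).le_max_zero_add ht.1 hC (by
        filter_upwards [hup x] with s hs hsm hpos
        linarith [hs hsm.1 (by linarith), hβpC s])
    have h2 := (((hVp x).neg.sub (isPrimitiveOn_const_add_mul L 0 _)).mono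
      (subset_univ (Icc 0 t))).le_max_zero_add ht.1 hC (by
        filter_upwards [hlo x] with s hs hsm hpos
        linarith [hs hsm.1 (by linarith), hβmC s])
    rw [hV0] at h1 h2
    have h3 : max (x - (L + 0 * 0)) 0 ≤ C * T := max_le (by linarith [hxK.2]) hCT
    have h4 : max (-x - (L + 0 * 0)) 0 ≤ C * T := max_le (by linarith [hxK.1]) hCT
    rw [huV t ht]
    exact abs_le.2 ⟨by linarith, by linarith⟩
  refine ⟨u, E, huper, fun a _ b _ _ => ⟨hEint a b, hu a b⟩, ?_, ?_⟩
  · refine ae_of_periodic_of_ae_Ioo hT (a := 0) (fun t => ?_) ?_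
    · have h1 : ∀ y, G (t + T) y = G t y := fun y => hper y t
      simp only [h1, huper t, hEper t]
    · filter_upwards [hVG x] with t ht htm y
      rw [zero_add] at htm
      rw [huV t ⟨htm.1.le, htm.2.le⟩, hEeq t ⟨htm.1, htm.2.le⟩]
      exact ht htm.1 y
  · intro t
    obtain ⟨s, hs, hts⟩ := huper.exists_mem_Ico₀ hT t
    rw [hts]
    exact hbound s ⟨hs.1, hs.2.le⟩

/-- Existence of a `T`-periodic solution of the scalar inclusion `v' ∈ [G(t, v+), G(t, v-)]` for
`G` periodic in time, antitone in the state and dissipative on average. -/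
theorem exists_periodic_solution {G : ℝ → ℝ → ℝ} {T : ℝ} (hT : 0 < T)
    (hanti : ∀ t, Antitone (G t)) (hmeas : ∀ x, Measurable fun t => G t x)
    (hper : ∀ x, Function.Periodic (fun t => G t x) T) (hbd : ∀ x, ∃ C₀, ∀ t, |G t x| ≤ C₀)
    {L C : ℝ} (hL : 0 ≤ L) (hC : 0 ≤ C) {βp βm : ℝ → ℝ}
    (hβp : ∀ t x, L < x → G t x ≤ βp t) (hβm : ∀ t x, x < -L → βm t ≤ G t x)
    (hβpC : ∀ t, βp t ≤ C) (hβmC : ∀ t, -C ≤ βm t)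
    (hβpi : IntervalIntegrable βp volume 0 T) (hβmi : IntervalIntegrable βm volume 0 T)
    (hp : ∫ s in (0 : ℝ)..T, βp s ≤ 0) (hm : 0 ≤ ∫ s in (0 : ℝ)..T, βm s) :
    ∃ v D : ℝ → ℝ, Function.Periodic v T ∧ IsPrimitiveOn v D univ ∧
      ∀ᵐ t ∂(volume : Measure ℝ), ∀ x, (v t < x → G t x ≤ D t) ∧ (x < v t → D t ≤ G t x) := by
  set R := L + 2 * C * T + 1 with hR
  have hCT : 0 ≤ C * T := mul_nonneg hC hT.le
  have hRL : L < R := by linarith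
  let c : ℝ → ℝ := fun x => max (-R) (min x R)
  have hcmono : Monotone c := fun x y hxy => max_le_max_left _ (min_le_min_right _ hxy)
  have hc1 : ∀ x, -R ≤ c x := fun x => le_max_left _ _
  have hc2 : ∀ x, c x ≤ R := fun x => max_le (by linarith) (min_le_right _ _)
  have hlt : ∀ x, -R < x → c x ≤ x := fun x hx => max_le hx.le (min_le_left _ _)
  have hgt : ∀ x, x < R → x ≤ c x := fun x hx =>
    le_max_of_le_right (le_min le_rfl hx.le)
  obtain ⟨C₁, hC₁⟩ := hbd R
  obtain ⟨C₂, hC₂⟩ := hbd (-R)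
  obtain ⟨v, D, hvper, hvD, hae, hvb⟩ := exists_periodic_solution_of_bounded
    (G := fun t x => G t (c x)) hT
    (fun t => (hanti t).comp_monotone hcmono) (fun x => hmeas (c x)) (fun x => hper (c x))
    (C₀ := max C₁ C₂) (fun t x => by
      have h1 := hanti t (hc1 x)
      have h2 := hanti t (hc2 x)
      have h3 := abs_le.1 (hC₁ t)
      have h4 := abs_le.1 (hC₂ t)
      exact abs_le.2 ⟨by linarith [le_max_left C₁ C₂], by linarith [le_max_right C₁ C₂]⟩)
    hL hC (fun t x hx => hβp t _ (lt_max_of_lt_right (lt_min hx hRL)))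
    (fun t x hx => hβm t _ (max_lt (by linarith) (min_lt_of_left_lt hx)))
    hβpC hβmC hβpi hβmi hp hm
  refine ⟨v, D, hvper, hvD, ?_⟩
  filter_upwards [hae] with t ht x
  have hb := abs_le.1 (hvb t)
  exact ⟨fun hx => (hanti t (hlt x (by linarith))).trans ((ht x).1 hx),
    fun hx => ((ht x).2 hx).trans (hanti t (hgt x (by linarith)))⟩

theorem setIntegral_mul_pos {f ρ : ℝ → ℝ} {K : Set ℝ} (hK : MeasurableSet K)
    (hf : ∀ ξ ∈ K, 0 < f ξ) (hρ : ∀ ξ, 0 ≤ ρ ξ) (h_int : IntegrableOn (fun ξ => f ξ * ρ ξ) K)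
    (hM : 0 < ∫ ξ in K, ρ ξ) : 0 < ∫ ξ in K, f ξ * ρ ξ := by
  have hnn : 0 ≤ᵐ[volume.restrict K] fun ξ => f ξ * ρ ξ := by
    filter_upwards [ae_restrict_mem hK] with ξ hξ using mul_nonneg (hf ξ hξ).le (hρ ξ)
  refine lt_of_le_of_ne (integral_nonneg_of_ae hnn) fun h0 => ?_
  have h1 := (integral_eq_zero_iff_of_nonneg_ae hnn h_int).1 h0.symm
  have h2 : ρ =ᵐ[volume.restrict K] 0 := by
    filter_upwards [h1, ae_restrict_mem hK] with ξ hξ hm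
    exact (mul_eq_zero.1 hξ).resolve_left (hf ξ hm).ne'
  rw [integral_congr_ae h2] at hM
  simp at hM

theorem exists_eq_zero_of_setIntegral_mul_eq_zero {f ρ : ℝ → ℝ} {a b : ℝ} (hab : a ≤ b)
    (hf : ContinuousOn f (Icc a b)) (hρ : ∀ ξ, 0 ≤ ρ ξ) (hρi : IntegrableOn ρ (Icc a b))
    (hM : 0 < ∫ ξ in Icc a b, ρ ξ) (h0 : ∫ ξ in Icc a b, f ξ * ρ ξ = 0) :
    ∃ ξ ∈ Icc a b, f ξ = 0 := by
  by_contra! hne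
  have ha : a ∈ Icc a b := left_mem_Icc.2 hab
  have h_int : IntegrableOn (fun ξ => f ξ * ρ ξ) (Icc a b) := hρi.continuousOn_mul hf isCompact_Icc
  rcases (hne a ha).lt_or_gt with hlt | hgt
  · have hneg : ∀ ξ ∈ Icc a b, 0 < -f ξ := by
      intro ξ hξ
      by_contra! hle
      obtain ⟨η, hη, h⟩ := isPreconnected_Icc.intermediate_value ha hξ hf
        ⟨hlt.le, by linarith⟩
      exact hne η hη h
    have h1 := setIntegral_mul_pos measurableSet_Icc hneg hρ
      (by simp only [neg_mul]; exact h_int.neg) hM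
    simp only [neg_mul, integral_neg, h0, neg_zero, lt_self_iff_false] at h1
  · have hpos : ∀ ξ ∈ Icc a b, 0 < f ξ := by
      intro ξ hξ
      by_contra! hle
      obtain ⟨η, hη, h⟩ := isPreconnected_Icc.intermediate_value hξ ha hf ⟨hle, hgt.le⟩
      exact hne η hη h
    exact (setIntegral_mul_pos measurableSet_Icc hpos hρ h_int hM).ne' h0

theorem abs_limsup_le {a : ℕ → ℝ} {L : ℝ} (h : ∀ n, |a n| ≤ L) : |limsup a atTop| ≤ L := by
  have h1 : ∀ n, a n ≤ L := fun n => (abs_le.1 (h n)).2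
  have h2 : ∀ n, -L ≤ a n := fun n => (abs_le.1 (h n)).1
  refine abs_le.2 ⟨?_, ?_⟩
  · exact le_limsup_of_frequently_le (Frequently.of_forall h2)
      (isBoundedUnder_of ⟨L, h1⟩)
  · exact limsup_le_of_le (isCoboundedUnder_le_of_le atTop h2) (Eventually.of_forall h1)

theorem exists_continuous_retraction_Icc {a b : ℝ} (hab : a ≤ b) :
    ∃ p : ℝ → ℝ, Continuous p ∧ (∀ ξ, p ξ ∈ Icc a b) ∧ ∀ ξ ∈ Icc a b, p ξ = ξ :=
  ⟨fun ξ => (projIcc a b hab ξ : ℝ), continuous_subtype_val.comp continuous_projIcc,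
    fun ξ => (projIcc a b hab ξ).2, fun ξ hξ => by simp only [projIcc_of_mem hab hξ]⟩

theorem tendsto_floor_mul_div (ξ : ℝ) :
    Tendsto (fun k : ℕ => (⌊ξ * ((k : ℝ) + 1)⌋ : ℝ) / ((k : ℝ) + 1)) atTop (𝓝 ξ) := by
  rw [tendsto_iff_dist_tendsto_zero]
  refine squeeze_zero (fun _ => dist_nonneg) (fun k => ?_)
    tendsto_one_div_add_atTop_nhds_zero_nat
  have hk : (0 : ℝ) < (k : ℝ) + 1 := by positivity
  have h2 := Int.floor_le (ξ * ((k : ℝ) + 1))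
  have h3 := Int.lt_floor_add_one (ξ * ((k : ℝ) + 1))
  rw [Real.dist_eq, div_sub' hk.ne', abs_div, abs_of_pos hk]
  refine div_le_div_of_nonneg_right (abs_le.2 ⟨by linarith, by linarith⟩) hk.le

/-- A limit of jointly measurable functions which is only known at almost every time for each
fixed `ξ`, but is continuous in `ξ`, has a jointly measurable representative. -/
theorem exists_measurable_limit {a b T L : ℝ} (hab : a ≤ b) {Q : ℕ → ℝ → ℝ → ℝ}
    {w : ℝ → ℝ → ℝ} (hQm : ∀ n, Measurable (Function.uncurry (Q n)))
    (hQb : ∀ n t ξ, |Q n t ξ| ≤ L) (hQper : ∀ n t ξ, Q n (t + T) ξ = Q n t ξ)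
    (hlim : ∀ ξ ∈ Icc a b, ∀ᵐ t ∂(volume : Measure ℝ),
      Tendsto (fun n => Q n t ξ) atTop (𝓝 (w t ξ)))
    (hw : ∀ᵐ t ∂(volume : Measure ℝ), ContinuousOn (fun ξ => w t ξ) (Icc a b)) :
    ∃ w' : ℝ → ℝ → ℝ, Measurable (Function.uncurry w') ∧
      (∀ ξ, Function.Periodic (fun t => w' t ξ) T) ∧ (∀ t ξ, |w' t ξ| ≤ L) ∧
      ∀ᵐ t ∂(volume : Measure ℝ), ∀ ξ ∈ Icc a b, w' t ξ = w t ξ := by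
  obtain ⟨p, hpc, hpm, hpe⟩ := exists_continuous_retraction_Icc hab
  obtain ⟨W, hWQ⟩ : ∃ W : ℝ → ℝ → ℝ, ∀ t ξ, W t ξ = limsup (fun n => Q n t ξ) atTop :=
    ⟨_, fun _ _ => rfl⟩
  obtain ⟨d, hd⟩ : ∃ d : ℕ → ℝ → ℝ,
      ∀ k ξ, d k ξ = p ((⌊ξ * ((k : ℝ) + 1)⌋ : ℝ) / ((k : ℝ) + 1)) := ⟨_, fun _ _ => rfl⟩
  have hWm : Measurable (Function.uncurry W) := by
    have h1 := Measurable.limsup (f := fun n (x : ℝ × ℝ) => Function.uncurry (Q n) x) hQm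
    convert h1 using 1
    ext x
    exact hWQ _ _
  have hWb : ∀ t ξ, |W t ξ| ≤ L := fun t ξ => by
    rw [hWQ]
    exact abs_limsup_le fun n => hQb n t ξ
  have hdm : ∀ k, Measurable (d k) := by
    intro k
    have h1 : Measurable fun ξ : ℝ => ((⌊ξ * ((k : ℝ) + 1)⌋ : ℤ) : ℝ) :=
      (measurable_from_top (f := fun m : ℤ => (m : ℝ))).comp
        (Int.measurable_floor.comp (measurable_id.mul_const _))
    rw [funext (hd k)]
    exact hpc.measurable.comp (h1.div_const _)
  have hdlim : ∀ ξ ∈ Icc a b, Tendsto (fun k => d k ξ) atTop (𝓝[Icc a b] ξ) := by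
    intro ξ hξ
    refine tendsto_nhdsWithin_iff.2 ⟨?_, Eventually.of_forall fun k => ?_⟩
    · have h2 := (hpc.tendsto ξ).comp (tendsto_floor_mul_div ξ)
      rw [hpe ξ hξ] at h2
      exact h2.congr fun k => (hd k ξ).symm
    · rw [hd]
      exact hpm _
  refine ⟨fun t ξ => limsup (fun k => W t (d k ξ)) atTop, ?_, fun ξ t => ?_, fun t ξ => ?_, ?_⟩
  · exact Measurable.limsup (f := fun (k : ℕ) (x : ℝ × ℝ) => Function.uncurry W (x.1, d k x.2))
      fun k => hWm.comp (measurable_fst.prodMk ((hdm k).comp measurable_snd))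
  · simp only [hWQ, hQper]
  · exact abs_limsup_le fun k => hWb _ _
  · have hgrid : ∀ᵐ t ∂(volume : Measure ℝ), ∀ (k : ℕ) (m : ℤ),
        Tendsto (fun n => Q n t (p ((m : ℝ) / ((k : ℝ) + 1)))) atTop
          (𝓝 (w t (p ((m : ℝ) / ((k : ℝ) + 1))))) := by
      rw [ae_all_iff]
      intro k
      rw [ae_all_iff]
      exact fun m => hlim _ (hpm _)
    filter_upwards [hgrid, hw] with t ht hc ξ hξ
    have h1 : ∀ k, W t (d k ξ) = w t (d k ξ) := fun k => by
      rw [hWQ, hd]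
      exact (ht k _).limsup_eq
    have h2 : Tendsto (fun k => w t (d k ξ)) atTop (𝓝 (w t ξ)) := (hc ξ hξ).tendsto.comp (hdlim ξ hξ)
    simp only [h1]
    exact h2.limsup_eq

/-- A jointly measurable, bounded and periodic representative of the relative velocity, which
vanishes somewhere on the body at almost every time. -/
theorem exists_measurable_velocity {T ξa ξb : ℝ} (hab : ξa < ξb) {ρ : ℝ → ℝ} {z w : ℝ → ℝ → ℝ}
    (hρ : ∀ ξ, 0 ≤ ρ ξ) (hρi : IntegrableOn ρ (Icc ξa ξb))
    (hM : 0 < ∫ ξ in Icc ξa ξb, ρ ξ)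
    (hzper : ∀ ξ, Function.Periodic (fun t => z t ξ) T)
    {L : NNReal} (hzt : ∀ ξ ∈ Icc ξa ξb, LipschitzWith L (fun t => z t ξ))
    (hzξ : ∀ t, ContinuousOn (fun ξ => z t ξ) (Icc ξa ξb))
    (hz0 : ∀ t, (∫ ξ in Icc ξa ξb, z t ξ * ρ ξ) = 0)
    (hzw : ∀ ξ ∈ Icc ξa ξb, ∀ᵐ t ∂(volume : Measure ℝ),
      HasDerivAt (fun s => z s ξ) (w t ξ) t)
    (hwcont : ∀ᵐ t ∂(volume : Measure ℝ), ContinuousOn (fun ξ => w t ξ) (Icc ξa ξb)) :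
    ∃ w' : ℝ → ℝ → ℝ, Measurable (Function.uncurry w') ∧
      (∀ ξ, Function.Periodic (fun t => w' t ξ) T) ∧ (∀ t ξ, |w' t ξ| ≤ L) ∧
      ∀ᵐ t ∂(volume : Measure ℝ), (∀ ξ ∈ Icc ξa ξb, w' t ξ = w t ξ) ∧
        ContinuousOn (w' t) (Icc ξa ξb) ∧ ∃ ξ ∈ Icc ξa ξb, w' t ξ = 0 := by
  obtain ⟨p, hpc, hpm, hpe⟩ := exists_continuous_retraction_Icc hab.le
  obtain ⟨Q, hQ⟩ : ∃ Q : ℕ → ℝ → ℝ → ℝ, ∀ n t ξ, Q n t ξ =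
    ((n : ℝ) + 1) * (z (t + 1 / ((n : ℝ) + 1)) (p ξ) - z t (p ξ)) := ⟨_, fun _ _ _ => rfl⟩
  have hzm : Measurable (Function.uncurry fun t ξ => z t (p ξ)) := by
    refine measurable_uncurry_of_continuous_of_measurable (u := fun t ξ => z t (p ξ))
      (fun ξ => (hzt _ (hpm ξ)).continuous) fun t => ?_
    exact ((hzξ t).comp_continuous hpc hpm).measurable
  have hQm : ∀ n, Measurable (Function.uncurry (Q n)) := by
    intro n
    have h1 : Measurable fun x : ℝ × ℝ => (x.1 + 1 / ((n : ℝ) + 1), x.2) :=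
      (measurable_fst.add_const _).prodMk measurable_snd
    have h2 := ((hzm.comp h1).sub hzm).const_mul ((n : ℝ) + 1)
    convert h2 using 1
    ext x
    exact hQ n x.1 x.2
  have hQb : ∀ n t ξ, |Q n t ξ| ≤ L := by
    intro n t ξ
    have hn : (0 : ℝ) < (n : ℝ) + 1 := by positivity
    have h1 := (hzt _ (hpm ξ)).dist_le_mul (t + 1 / ((n : ℝ) + 1)) t
    have h2 : |1 / ((n : ℝ) + 1)| = 1 / ((n : ℝ) + 1) := abs_of_pos (by positivity)
    rw [Real.dist_eq, Real.dist_eq, add_sub_cancel_left, h2] at h1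
    rw [hQ, abs_mul, abs_of_pos hn]
    calc _ ≤ ((n : ℝ) + 1) * (L * (1 / ((n : ℝ) + 1))) := mul_le_mul_of_nonneg_left h1 hn.le
      _ = L := by field_simp
  have hQlim : ∀ ξ ∈ Icc ξa ξb, ∀ᵐ t ∂(volume : Measure ℝ),
      Tendsto (fun n => Q n t ξ) atTop (𝓝 (w t ξ)) := by
    intro ξ hξ
    filter_upwards [hzw ξ hξ] with t hd
    have h1 : Tendsto (fun n : ℕ => 1 / ((n : ℝ) + 1)) atTop (𝓝[>] 0) :=
      tendsto_nhdsWithin_iff.2 ⟨tendsto_one_div_add_atTop_nhds_zero_nat,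
        Eventually.of_forall fun n => by
          simp only [mem_Ioi]
          positivity⟩
    refine (hd.tendsto_slope_zero_right.comp h1).congr fun n => ?_
    simp only [hQ, hpe ξ hξ, Function.comp, smul_eq_mul, one_div, inv_inv]
  have hQper : ∀ n t ξ, Q n (t + T) ξ = Q n t ξ := by
    intro n t ξ
    have h1 : z (t + T + 1 / ((n : ℝ) + 1)) (p ξ) = z (t + 1 / ((n : ℝ) + 1)) (p ξ) := by
      rw [add_right_comm]
      exact hzper (p ξ) _
    have h2 : z (t + T) (p ξ) = z t (p ξ) := hzper (p ξ) t
    simp only [hQ, h1, h2]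
  obtain ⟨w', hw'm, hw'per, hw'b, hw'w⟩ :=
    exists_measurable_limit hab.le hQm hQb hQper hQlim hwcont
  have hcomm : ∀ᵐ t ∂(volume : Measure ℝ), ∀ᵐ ξ ∂(volume.restrict (Icc ξa ξb)),
      Tendsto (fun n => Q n t ξ) atTop (𝓝 (w' t ξ)) := by
    have h1 : MeasurableSet {x : ℝ × ℝ | Tendsto (fun n => Function.uncurry (Q n) x) atTop
        (𝓝 (Function.uncurry w' x))} := measurableSet_tendsto_fun hQm hw'm
    refine (Measure.ae_ae_comm (p := fun t ξ => Tendsto (fun n => Q n t ξ) atTop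
      (𝓝 (w' t ξ))) h1).2 ?_
    filter_upwards [ae_restrict_mem measurableSet_Icc] with ξ hξ
    filter_upwards [hQlim ξ hξ, hw'w] with t h1 h2
    rw [h2 ξ hξ]
    exact h1
  refine ⟨w', hw'm, hw'per, hw'b, ?_⟩
  filter_upwards [hw'w, hwcont, hcomm] with t h1 h2 h3
  have hc : ContinuousOn (w' t) (Icc ξa ξb) := h2.congr h1
  refine ⟨h1, hc, exists_eq_zero_of_setIntegral_mul_eq_zero hab.le hc hρ hρi hM ?_⟩
  have hQ0 : ∀ n, ∫ ξ in Icc ξa ξb, Q n t ξ * ρ ξ = 0 := by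
    intro n
    have hi : ∀ s, IntegrableOn (fun ξ => z s ξ * ρ ξ) (Icc ξa ξb) := fun s =>
      hρi.continuousOn_mul (hzξ s) isCompact_Icc
    have h4 : ∫ ξ in Icc ξa ξb, Q n t ξ * ρ ξ = ∫ ξ in Icc ξa ξb,
        ((n : ℝ) + 1) * (z (t + 1 / ((n : ℝ) + 1)) ξ * ρ ξ - z t ξ * ρ ξ) := by
      refine setIntegral_congr_fun measurableSet_Icc fun ξ hξ => ?_
      simp only [hQ, hpe ξ hξ]
      ring
    rw [h4, integral_const_mul, integral_sub (hi _) (hi _), hz0, hz0]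
    simp
  refine tendsto_nhds_unique (tendsto_integral_of_dominated_convergence
    (F := fun n ξ => Q n t ξ * ρ ξ) (fun ξ => L * ρ ξ)
    (fun n => ?_) (hρi.const_mul _) (fun n => ae_of_all _ fun ξ => ?_) ?_)
    (tendsto_const_nhds.congr fun n => (hQ0 n).symm)
  · have h4 : Measurable fun ξ => Q n t ξ := (hQm n).comp measurable_prodMk_left
    exact h4.aestronglyMeasurable.mul hρi.aestronglyMeasurable
  · rw [norm_mul, Real.norm_eq_abs, Real.norm_of_nonneg (hρ ξ)]
    exact mul_le_mul_of_nonneg_right (hQb n t ξ) (hρ ξ)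
  · filter_upwards [h3] with ξ hξ using hξ.mul_const _

/-- Largest value of the friction force density. -/
noncomputable def fricUp (μp μm : ℝ → ℝ → ℝ) (q : ℝ → ℝ → ℝ → ℝ) (t ξ u : ℝ) : ℝ :=
  (if 0 < u then -μp t ξ else μm t ξ) + q t ξ u

/-- Smallest value of the friction force density. -/
noncomputable def fricLo (μp μm : ℝ → ℝ → ℝ) (q : ℝ → ℝ → ℝ → ℝ) (t ξ u : ℝ) : ℝ :=
  (if u < 0 then μm t ξ else -μp t ξ) + q t ξ u

theorem fric_eq_Icc (μp μm : ℝ → ℝ → ℝ) (q : ℝ → ℝ → ℝ → ℝ) (t ξ u : ℝ) :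
    fric μp μm q t ξ u = Icc (fricLo μp μm q t ξ u) (fricUp μp μm q t ξ u) := by
  ext x
  simp only [fric, dryH, fricLo, fricUp, mem_ofPred_eq, mem_Icc]
  rcases lt_trichotomy u 0 with h | h | h
  · simp only [h.not_gt, h, if_false, if_true, mem_singleton_iff, exists_eq_left]
    exact ⟨fun hx => ⟨hx.ge, hx.le⟩, fun hx => le_antisymm hx.2 hx.1⟩
  · simp only [h, lt_self_iff_false, if_false, mem_Icc]
    constructor
    · rintro ⟨y, hy, rfl⟩
      exact ⟨by linarith, by linarith⟩
    · exact fun hx => ⟨x - q t ξ 0, ⟨by linarith, by linarith⟩, by ring⟩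
  · simp only [h.not_gt, h, if_false, if_true, mem_singleton_iff, exists_eq_left]
    exact ⟨fun hx => ⟨hx.ge, hx.le⟩, fun hx => le_antisymm hx.2 hx.1⟩

/-- The regularity used of the crawler model: measurable, bounded and periodic data, and a
nonincreasing continuous perturbation vanishing at rest. -/
structure CrawlerField (T a b M C L : ℝ) (B : ℝ → ℝ) (μp μm : ℝ → ℝ → ℝ)
    (q : ℝ → ℝ → ℝ → ℝ) (w : ℝ → ℝ → ℝ) : Prop where
  period_pos : 0 < T
  lt : a < b
  mass_pos : 0 < M
  measurable_force : Measurable B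
  abs_force_le : ∀ t, |B t| ≤ C
  periodic_force : Function.Periodic B T
  measurable_mup : Measurable (Function.uncurry μp)
  measurable_mum : Measurable (Function.uncurry μm)
  mup_nonneg : ∀ t ξ, 0 ≤ μp t ξ
  mum_nonneg : ∀ t ξ, 0 ≤ μm t ξ
  mup_le : ∀ t ξ, μp t ξ ≤ C
  mum_le : ∀ t ξ, μm t ξ ≤ C
  periodic_mup : ∀ t ξ, μp (t + T) ξ = μp t ξ
  periodic_mum : ∀ t ξ, μm (t + T) ξ = μm t ξ
  measurable_q : ∀ u, Measurable fun s : ℝ × ℝ => q s.1 s.2 u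
  continuous_q : ∀ t ξ, Continuous (q t ξ)
  antitone_q : ∀ t ξ, Antitone (q t ξ)
  q_zero : ∀ t ξ, q t ξ 0 = 0
  abs_q_le : ∀ r, ∃ K, ∀ t ξ u, |u| ≤ r → |q t ξ u| ≤ K
  periodic_q : ∀ t ξ u, q (t + T) ξ u = q t ξ u
  measurable_w : Measurable (Function.uncurry w)
  periodic_w : ∀ t ξ, w (t + T) ξ = w t ξ
  abs_w_le : ∀ t ξ, |w t ξ| ≤ L

/-- Largest admissible acceleration at time `t` and velocity `x`. -/
noncomputable def accUp (a b M : ℝ) (B : ℝ → ℝ) (μp μm : ℝ → ℝ → ℝ) (q : ℝ → ℝ → ℝ → ℝ)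
    (w : ℝ → ℝ → ℝ) (t x : ℝ) : ℝ :=
  (B t + ∫ ξ in Icc a b, fricUp μp μm q t ξ (x + w t ξ)) / M

/-- Smallest admissible acceleration at time `t` and velocity `x`. -/
noncomputable def accLo (a b M : ℝ) (B : ℝ → ℝ) (μp μm : ℝ → ℝ → ℝ) (q : ℝ → ℝ → ℝ → ℝ)
    (w : ℝ → ℝ → ℝ) (t x : ℝ) : ℝ :=
  (B t + ∫ ξ in Icc a b, fricLo μp μm q t ξ (x + w t ξ)) / M

namespace CrawlerField

variable {T a b M C L : ℝ} {B : ℝ → ℝ} {μp μm : ℝ → ℝ → ℝ} {q : ℝ → ℝ → ℝ → ℝ} {w : ℝ → ℝ → ℝ}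

theorem fricUp_le_fricLo (h : CrawlerField T a b M C L B μp μm q w) (t ξ : ℝ) {u u' : ℝ}
    (hu : u < u') : fricUp μp μm q t ξ u' ≤ fricLo μp μm q t ξ u := by
  have h1 := h.antitone_q t ξ hu.le
  have h2 := h.mup_nonneg t ξ
  have h3 := h.mum_nonneg t ξ
  simp only [fricUp, fricLo]
  split_ifs <;> linarith

theorem fricLo_le_fricUp (h : CrawlerField T a b M C L B μp μm q w) (t ξ u : ℝ) :
    fricLo μp μm q t ξ u ≤ fricUp μp μm q t ξ u := by
  have h2 := h.mup_nonneg t ξ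
  have h3 := h.mum_nonneg t ξ
  simp only [fricUp, fricLo]
  split_ifs <;> linarith

theorem measurable_fric_comp (h : CrawlerField T a b M C L B μp μm q w) (x : ℝ) :
    Measurable (Function.uncurry fun t ξ => fricUp μp μm q t ξ (x + w t ξ)) ∧
      Measurable (Function.uncurry fun t ξ => fricLo μp μm q t ξ (x + w t ξ)) := by
  have hu : Measurable fun s : ℝ × ℝ => x + w s.1 s.2 := h.measurable_w.const_add x
  have hq : Measurable fun s : ℝ × ℝ => q s.1 s.2 (x + w s.1 s.2) := by
    have h1 : Measurable (Function.uncurry fun (u : ℝ) (s : ℝ × ℝ) => q s.1 s.2 u) :=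
      measurable_uncurry_of_continuous_of_measurable
        (u := fun (u : ℝ) (s : ℝ × ℝ) => q s.1 s.2 u) (fun s => h.continuous_q s.1 s.2)
        h.measurable_q
    exact h1.comp (hu.prodMk measurable_id)
  exact ⟨(Measurable.ite (measurableSet_lt measurable_const hu) h.measurable_mup.neg
      h.measurable_mum).add hq,
    (Measurable.ite (measurableSet_lt hu measurable_const) h.measurable_mum
      h.measurable_mup.neg).add hq⟩

theorem abs_fric_le (h : CrawlerField T a b M C L B μp μm q w) (r : ℝ) :
    ∃ K, ∀ t ξ x, |x| ≤ r → |fricUp μp μm q t ξ (x + w t ξ)| ≤ K ∧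
      |fricLo μp μm q t ξ (x + w t ξ)| ≤ K := by
  obtain ⟨K, hK⟩ := h.abs_q_le (r + L)
  refine ⟨C + K, fun t ξ x hx => ?_⟩
  have h1 := abs_le.1 (hK t ξ (x + w t ξ) ((abs_add_le _ _).trans (add_le_add hx (h.abs_w_le t ξ))))
  have h2 := h.mup_nonneg t ξ
  have h3 := h.mum_nonneg t ξ
  have h4 := h.mup_le t ξ
  have h5 := h.mum_le t ξ
  simp only [fricUp, fricLo, abs_le]
  constructor
  all_goals split_ifs <;> constructor <;> linarith

theorem integrableOn_of_abs_le {g : ℝ → ℝ} (hg : Measurable g) {K : ℝ} (hK : ∀ ξ, |g ξ| ≤ K) :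
    IntegrableOn g (Icc a b) :=
  Measure.integrableOn_of_bounded measure_Icc_lt_top.ne hg.aestronglyMeasurable
    (ae_of_all _ fun ξ => hK ξ)

theorem integrableOn_fricUp (h : CrawlerField T a b M C L B μp μm q w) (t x : ℝ) :
    IntegrableOn (fun ξ => fricUp μp μm q t ξ (x + w t ξ)) (Icc a b) := by
  obtain ⟨K, hK⟩ := h.abs_fric_le |x|
  exact integrableOn_of_abs_le ((h.measurable_fric_comp x).1.comp measurable_prodMk_left)
    fun ξ => (hK t ξ x le_rfl).1

theorem integrableOn_fricLo (h : CrawlerField T a b M C L B μp μm q w) (t x : ℝ) :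
    IntegrableOn (fun ξ => fricLo μp μm q t ξ (x + w t ξ)) (Icc a b) := by
  obtain ⟨K, hK⟩ := h.abs_fric_le |x|
  exact integrableOn_of_abs_le ((h.measurable_fric_comp x).2.comp measurable_prodMk_left)
    fun ξ => (hK t ξ x le_rfl).2

theorem integrableOn_mup (h : CrawlerField T a b M C L B μp μm q w) (t : ℝ) :
    IntegrableOn (μp t) (Icc a b) :=
  integrableOn_of_abs_le (h.measurable_mup.comp measurable_prodMk_left)
    fun ξ => by rw [abs_of_nonneg (h.mup_nonneg t ξ)]; exact h.mup_le t ξ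

theorem integrableOn_mum (h : CrawlerField T a b M C L B μp μm q w) (t : ℝ) :
    IntegrableOn (μm t) (Icc a b) :=
  integrableOn_of_abs_le (h.measurable_mum.comp measurable_prodMk_left)
    fun ξ => by rw [abs_of_nonneg (h.mum_nonneg t ξ)]; exact h.mum_le t ξ

theorem accUp_le_accLo (h : CrawlerField T a b M C L B μp μm q w) (t : ℝ) {x x' : ℝ}
    (hx : x < x') : accUp a b M B μp μm q w t x' ≤ accLo a b M B μp μm q w t x := by
  refine div_le_div_of_nonneg_right (add_le_add_right ?_ _) h.mass_pos.le
  exact setIntegral_mono (h.integrableOn_fricUp t x') (h.integrableOn_fricLo t x) fun ξ =>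
    h.fricUp_le_fricLo t ξ (by linarith)

theorem accLo_le_accUp (h : CrawlerField T a b M C L B μp μm q w) (t x : ℝ) :
    accLo a b M B μp μm q w t x ≤ accUp a b M B μp μm q w t x := by
  refine div_le_div_of_nonneg_right (add_le_add_right ?_ _) h.mass_pos.le
  exact setIntegral_mono (h.integrableOn_fricLo t x) (h.integrableOn_fricUp t x) fun ξ =>
    h.fricLo_le_fricUp t ξ _

theorem accUp_le_of_pos (h : CrawlerField T a b M C L B μp μm q w) {t x : ℝ}
    (hx : ∀ ξ ∈ Icc a b, 0 < x + w t ξ) :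
    accUp a b M B μp μm q w t x ≤ (B t - ∫ ξ in Icc a b, μp t ξ) / M := by
  rw [sub_eq_add_neg, ← integral_neg]
  refine div_le_div_of_nonneg_right (add_le_add_right ?_ _) h.mass_pos.le
  refine setIntegral_mono_on (h.integrableOn_fricUp t x) (h.integrableOn_mup t).neg
    measurableSet_Icc fun ξ hξ => ?_
  have h1 := h.antitone_q t ξ (hx ξ hξ).le
  rw [h.q_zero] at h1
  simp only [fricUp, hx ξ hξ, if_true]
  linarith

theorem le_accLo_of_neg (h : CrawlerField T a b M C L B μp μm q w) {t x : ℝ}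
    (hx : ∀ ξ ∈ Icc a b, x + w t ξ < 0) :
    (B t + ∫ ξ in Icc a b, μm t ξ) / M ≤ accLo a b M B μp μm q w t x := by
  refine div_le_div_of_nonneg_right (add_le_add_right ?_ _) h.mass_pos.le
  refine setIntegral_mono_on (h.integrableOn_mum t) (h.integrableOn_fricLo t x)
    measurableSet_Icc fun ξ hξ => ?_
  have h1 := h.antitone_q t ξ (hx ξ hξ).le
  rw [h.q_zero] at h1
  simp only [fricLo, hx ξ hξ, if_true]
  linarith

/-- A solution of the inclusion is a primitive of a function lying between the extreme
admissible accelerations. -/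
theorem isCSolOn_iff (h : CrawlerField T a b M C L B μp μm q w) {w' : ℝ → ℝ → ℝ}
    (hw : ∀ᵐ t ∂(volume : Measure ℝ), ∀ ξ ∈ Icc a b, w t ξ = w' t ξ) {v : ℝ → ℝ} {I : Set ℝ} :
    IsCSolOn (Icc a b) M B w' (fric μp μm q) v I ↔ ∃ D, IsPrimitiveOn v D I ∧
      ∀ᵐ t ∂(volume : Measure ℝ), t ∈ I →
        D t ∈ Icc (accLo a b M B μp μm q w t (v t)) (accUp a b M B μp μm q w t (v t)) := by
  refine exists_congr fun D => and_congr Iff.rfl ⟨fun hD => ?_, fun hD => ?_⟩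
  · filter_upwards [hD, hw] with t ht hwt htI
    obtain ⟨g, hg, hgm, hgD⟩ := ht htI
    have hg' : ∀ᵐ ξ ∂(volume : Measure ℝ), ξ ∈ Icc a b →
        fricLo μp μm q t ξ (v t + w t ξ) ≤ g ξ ∧ g ξ ≤ fricUp μp μm q t ξ (v t + w t ξ) := by
      filter_upwards [hgm] with ξ hξ hm
      have h1 := hξ hm
      rwa [fric_eq_Icc, ← hwt ξ hm] at h1
    rw [hgD]
    constructor
    · refine div_le_div_of_nonneg_right (add_le_add_right ?_ _) h.mass_pos.le
      refine setIntegral_mono_on_ae (h.integrableOn_fricLo t _) hg measurableSet_Icc ?_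
      filter_upwards [hg'] with ξ hξ hm using (hξ hm).1
    · refine div_le_div_of_nonneg_right (add_le_add_right ?_ _) h.mass_pos.le
      refine setIntegral_mono_on_ae hg (h.integrableOn_fricUp t _) measurableSet_Icc ?_
      filter_upwards [hg'] with ξ hξ hm using (hξ hm).2
  · filter_upwards [hD, hw] with t ht hwt htI
    have hlo := h.integrableOn_fricLo t (v t)
    have hup := h.integrableOn_fricUp t (v t)
    rw [← segment_eq_Icc (h.accLo_le_accUp t (v t)), segment_eq_image] at ht
    obtain ⟨θ, hθ, hθD⟩ := ht htI
    refine ⟨fun ξ => (1 - θ) * fricLo μp μm q t ξ (v t + w t ξ) +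
      θ * fricUp μp μm q t ξ (v t + w t ξ), (hlo.const_mul _).add (hup.const_mul _),
      ae_of_all _ fun ξ hξ => ?_, ?_⟩
    · rw [fric_eq_Icc, ← hwt ξ hξ]
      have h1 := h.fricLo_le_fricUp t ξ (v t + w t ξ)
      constructor <;> nlinarith [hθ.1, hθ.2]
    · rw [integral_add (hlo.const_mul _) (hup.const_mul _), integral_const_mul,
        integral_const_mul, ← hθD]
      simp only [accLo, accUp, smul_eq_mul]
      ring

end CrawlerField

namespace CrawlerField

variable {T a b M C L : ℝ} {B : ℝ → ℝ} {μp μm : ℝ → ℝ → ℝ} {q : ℝ → ℝ → ℝ → ℝ} {w : ℝ → ℝ → ℝ}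

theorem tendsto_fricUp_left (h : CrawlerField T a b M C L B μp μm q w) (t ξ u : ℝ) {e : ℕ → ℝ}
    (he : ∀ n, e n ≤ u) (hlim : Tendsto e atTop (𝓝 u)) :
    Tendsto (fun n => fricUp μp μm q t ξ (e n)) atTop (𝓝 (fricUp μp μm q t ξ u)) := by
  refine Tendsto.add ?_ (((h.continuous_q t ξ).tendsto u).comp hlim)
  refine tendsto_const_nhds.congr' ?_
  by_cases hu : 0 < u
  · filter_upwards [hlim.eventually (lt_mem_nhds hu)] with n hn
    simp only [hu, hn, if_true]
  · refine Eventually.of_forall fun n => ?_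
    simp only [hu, ((he n).trans (not_lt.1 hu)).not_gt, if_false]

theorem tendsto_fricUp_right (h : CrawlerField T a b M C L B μp μm q w) (t ξ u : ℝ) {e : ℕ → ℝ}
    (he : ∀ n, u < e n) (hlim : Tendsto e atTop (𝓝 u)) :
    Tendsto (fun n => fricUp μp μm q t ξ (e n)) atTop (𝓝 (fricLo μp μm q t ξ u)) := by
  refine Tendsto.add ?_ (((h.continuous_q t ξ).tendsto u).comp hlim)
  refine tendsto_const_nhds.congr' ?_
  by_cases hu : u < 0
  · filter_upwards [hlim.eventually (gt_mem_nhds hu)] with n hn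
    simp only [hu, hn.not_gt, if_true, if_false]
  · refine Eventually.of_forall fun n => ?_
    simp only [hu, (not_lt.1 hu).trans_lt (he n), if_true, if_false]

theorem tendsto_accUp (h : CrawlerField T a b M C L B μp μm q w) (t : ℝ) {r : ℝ} {e : ℕ → ℝ}
    (he : ∀ n, |e n| ≤ r) {φ : ℝ → ℝ}
    (hlim : ∀ ξ, Tendsto (fun n => fricUp μp μm q t ξ (e n + w t ξ)) atTop (𝓝 (φ ξ))) :
    Tendsto (fun n => accUp a b M B μp μm q w t (e n)) atTop
      (𝓝 ((B t + ∫ ξ in Icc a b, φ ξ) / M)) := by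
  obtain ⟨K, hK⟩ := h.abs_fric_le r
  refine Tendsto.div_const (Tendsto.const_add _ ?_) _
  refine tendsto_integral_of_dominated_convergence (fun _ => K)
    (fun n => (h.integrableOn_fricUp t (e n)).aestronglyMeasurable) ?_
    (fun n => ae_of_all _ fun ξ => (hK t ξ (e n) (he n)).1) (ae_of_all _ hlim)
  exact integrableOn_const measure_Icc_lt_top.ne

theorem mem_Icc_acc (h : CrawlerField T a b M C L B μp μm q w) {t v d : ℝ}
    (hd : ∀ x, (v < x → accUp a b M B μp μm q w t x ≤ d) ∧
      (x < v → d ≤ accUp a b M B μp μm q w t x)) :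
    d ∈ Icc (accLo a b M B μp μm q w t v) (accUp a b M B μp μm q w t v) := by
  have hpos : ∀ n : ℕ, (0 : ℝ) < 1 / ((n : ℝ) + 1) := fun n => by positivity
  have hle : ∀ n : ℕ, 1 / ((n : ℝ) + 1) ≤ 1 := fun n => by
    rw [div_le_one (by positivity)]
    linarith [n.cast_nonneg (α := ℝ)]
  have h0 : Tendsto (fun n : ℕ => 1 / ((n : ℝ) + 1)) atTop (𝓝 0) :=
    tendsto_one_div_add_atTop_nhds_zero_nat
  have habs : ∀ n : ℕ, |1 / ((n : ℝ) + 1)| ≤ 1 := fun n => by rw [abs_of_pos (hpos n)]; exact hle n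
  constructor
  · refine le_of_tendsto (h.tendsto_accUp t (r := |v| + 1) (e := fun n : ℕ => v + 1 / ((n : ℝ) + 1))
      (fun n => (abs_add_le _ _).trans (add_le_add le_rfl (habs n)))
      (fun ξ => h.tendsto_fricUp_right t ξ (v + w t ξ) (fun n => ?_) ?_))
      (Eventually.of_forall fun n => (hd _).1 ?_)
    · linarith [hpos n]
    · simpa using (h0.const_add v).add_const (w t ξ)
    · linarith [hpos n]
  · refine ge_of_tendsto (h.tendsto_accUp t (r := |v| + 1) (e := fun n : ℕ => v - 1 / ((n : ℝ) + 1))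
      (fun n => (abs_sub _ _).trans (add_le_add le_rfl (habs n)))
      (fun ξ => h.tendsto_fricUp_left t ξ (v + w t ξ) (fun n => ?_) ?_))
      (Eventually.of_forall fun n => (hd _).2 ?_)
    · linarith [hpos n]
    · simpa using (h0.const_sub v).add_const (w t ξ)
    · linarith [hpos n]

theorem measurable_setIntegral {g : ℝ → ℝ → ℝ} (hg : Measurable (Function.uncurry g)) :
    Measurable fun t => ∫ ξ in Icc a b, g t ξ :=
  (StronglyMeasurable.integral_prod_right (ν := volume.restrict (Icc a b))
    hg.stronglyMeasurable).measurable

theorem abs_setIntegral_le {g : ℝ → ℝ} {K : ℝ} (hK : ∀ ξ, |g ξ| ≤ K) :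
    |∫ ξ in Icc a b, g ξ| ≤ K * volume.real (Icc a b) := by
  rw [← Real.norm_eq_abs]
  exact norm_setIntegral_le_of_norm_le_const measure_Icc_lt_top fun ξ _ => hK ξ

theorem setIntegral_mup_nonneg (h : CrawlerField T a b M C L B μp μm q w) (t : ℝ) :
    0 ≤ ∫ ξ in Icc a b, μp t ξ := integral_nonneg (h.mup_nonneg t)

theorem setIntegral_mum_nonneg (h : CrawlerField T a b M C L B μp μm q w) (t : ℝ) :
    0 ≤ ∫ ξ in Icc a b, μm t ξ := integral_nonneg (h.mum_nonneg t)

theorem force_bound_nonneg (h : CrawlerField T a b M C L B μp μm q w) : 0 ≤ C :=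
  (abs_nonneg _).trans (h.abs_force_le 0)

theorem intervalIntegrable_lower (h : CrawlerField T a b M C L B μp μm q w) (s t : ℝ) :
    IntervalIntegrable (fun t => (B t - ∫ ξ in Icc a b, μp t ξ) / M) volume s t := by
  refine IntervalIntegrable.div_const ((intervalIntegrable_of_abs_le h.measurable_force
    h.abs_force_le s t).sub (intervalIntegrable_of_abs_le (measurable_setIntegral
    h.measurable_mup) (C := C * volume.real (Icc a b)) (fun t => abs_setIntegral_le fun ξ => ?_)
    s t)) M
  rw [abs_of_nonneg (h.mup_nonneg t ξ)]
  exact h.mup_le t ξ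

theorem intervalIntegrable_upper (h : CrawlerField T a b M C L B μp μm q w) (s t : ℝ) :
    IntervalIntegrable (fun t => (B t + ∫ ξ in Icc a b, μm t ξ) / M) volume s t := by
  refine IntervalIntegrable.div_const ((intervalIntegrable_of_abs_le h.measurable_force
    h.abs_force_le s t).add (intervalIntegrable_of_abs_le (measurable_setIntegral
    h.measurable_mum) (C := C * volume.real (Icc a b)) (fun t => abs_setIntegral_le fun ξ => ?_)
    s t)) M
  rw [abs_of_nonneg (h.mum_nonneg t ξ)]
  exact h.mum_le t ξ

theorem exists_periodic (h : CrawlerField T a b M C L B μp μm q w)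
    (hp : ∫ s in (0 : ℝ)..T, (B s - ∫ ξ in Icc a b, μp s ξ) / M ≤ 0)
    (hm : 0 ≤ ∫ s in (0 : ℝ)..T, (B s + ∫ ξ in Icc a b, μm s ξ) / M) :
    ∃ v D : ℝ → ℝ, Function.Periodic v T ∧ IsPrimitiveOn v D univ ∧
      ∀ᵐ t ∂(volume : Measure ℝ),
        D t ∈ Icc (accLo a b M B μp μm q w t (v t)) (accUp a b M B μp μm q w t (v t)) := by
  have hL : 0 ≤ L := (abs_nonneg _).trans (h.abs_w_le 0 0)
  have hM := h.mass_pos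
  suffices key : ∃ v D : ℝ → ℝ, Function.Periodic v T ∧ IsPrimitiveOn v D univ ∧
      ∀ᵐ t ∂(volume : Measure ℝ), ∀ x, (v t < x → accUp a b M B μp μm q w t x ≤ D t) ∧
        (x < v t → D t ≤ accUp a b M B μp μm q w t x) by
    obtain ⟨v, D, hv, hD, hG⟩ := key
    exact ⟨v, D, hv, hD, hG.mono fun t ht => h.mem_Icc_acc ht⟩
  refine exists_periodic_solution (G := accUp a b M B μp μm q w)
    h.period_pos ?_ ?_ ?_ ?_ hL (C := C / M) (div_nonneg h.force_bound_nonneg hM.le)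
    (fun t x hx => h.accUp_le_of_pos (x := x) (t := t) fun ξ _ => ?_)
    (fun t x hx => (h.le_accLo_of_neg (x := x) (t := t) fun ξ _ => ?_).trans
      (h.accLo_le_accUp t x)) ?_ ?_
    (h.intervalIntegrable_lower 0 T) (h.intervalIntegrable_upper 0 T) hp hm
  · intro t x y hxy
    rcases hxy.eq_or_lt with rfl | hlt
    · exact le_rfl
    · exact (h.accUp_le_accLo t hlt).trans (h.accLo_le_accUp t x)
  · intro x
    exact (h.measurable_force.add
      (measurable_setIntegral (h.measurable_fric_comp x).1)).div_const M
  · intro x t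
    simp only [accUp, fricUp, h.periodic_w, h.periodic_mup, h.periodic_mum, h.periodic_q,
      h.periodic_force t]
  · intro x
    obtain ⟨K, hK⟩ := h.abs_fric_le |x|
    refine ⟨(C + K * volume.real (Icc a b)) / M, fun t => ?_⟩
    rw [accUp, abs_div, abs_of_pos hM]
    refine div_le_div_of_nonneg_right ((abs_add_le _ _).trans (add_le_add (h.abs_force_le t)
      (abs_setIntegral_le fun ξ => (hK t ξ x le_rfl).1))) hM.le
  · have := (abs_le.1 (h.abs_w_le t ξ)).1
    linarith
  · have := (abs_le.1 (h.abs_w_le t ξ)).2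
    linarith
  · intro t
    refine div_le_div_of_nonneg_right ?_ hM.le
    linarith [(abs_le.1 (h.abs_force_le t)).2, h.setIntegral_mup_nonneg t]
  · intro t
    rw [← neg_div]
    refine div_le_div_of_nonneg_right ?_ hM.le
    linarith [(abs_le.1 (h.abs_force_le t)).1, h.setIntegral_mum_nonneg t]

end CrawlerField

theorem IsPrimitiveOn.integral_period_nonneg {e E β : ℝ → ℝ} {T t₀ m : ℝ} (hT : 0 < T)
    (he : IsPrimitiveOn e E (Ici t₀)) (hper : Function.Periodic β T)
    (hβ : ∀ s t, IntervalIntegrable β volume s t)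
    (hE : ∀ᵐ t ∂(volume : Measure ℝ), t ∈ Ici t₀ → E t ≤ β t) (hm : ∀ t ∈ Ici t₀, m ≤ e t) :
    0 ≤ ∫ s in (0 : ℝ)..T, β s := by
  by_contra! hneg
  obtain ⟨n, hn⟩ := exists_nat_gt ((e t₀ - m) / -∫ s in (0 : ℝ)..T, β s)
  rw [div_lt_iff₀ (neg_pos.2 hneg)] at hn
  have hle : t₀ ≤ t₀ + (n : ℤ) • T := by
    have : 0 ≤ (n : ℤ) • T := zsmul_nonneg hT.le n.cast_nonneg
    linarith
  obtain ⟨h1, h2⟩ := he t₀ self_mem_Ici _ (mem_Ici.2 hle) hle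
  have h3 := intervalIntegral_mono_of_ae_Ioc hle h1 (hβ _ _)
    (hE.mono fun t ht htm => ht htm.1.le)
  rw [hper.intervalIntegral_add_zsmul_eq (n : ℤ) t₀ hβ, ← h2,
    hper.intervalIntegral_add_eq t₀ 0, zero_add] at h3
  have h4 := hm _ (mem_Ici.2 hle)
  simp only [zsmul_eq_mul, Int.cast_natCast] at h3 h4
  linarith

theorem IsPreconnected.forall_nonneg_or_forall_le_neg {X : Type*} [TopologicalSpace X] {S : Set X}
    (hS : IsPreconnected S) {f : X → ℝ} (hf : ContinuousOn f S) {c : ℝ} (hc : 0 < c)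
    (h : ∀ x ∈ S, 0 ≤ f x ∨ f x ≤ -c) : (∀ x ∈ S, 0 ≤ f x) ∨ ∀ x ∈ S, f x ≤ -c := by
  by_contra! hne
  obtain ⟨⟨x, hx, hfx⟩, y, hy, hfy⟩ := hne
  have h1 := (h x hx).resolve_left hfx.not_ge
  have h2 := (h y hy).resolve_right hfy.not_ge
  obtain ⟨u, hu, hfu⟩ := hS.intermediate_value hx hy hf
    (show -c / 2 ∈ Icc (f x) (f y) from ⟨by linarith, by linarith⟩)
  rcases h u hu with h3 | h3 <;> linarith

theorem Function.Periodic.exists_abs_le_of_continuous {p : ℝ → ℝ} {T : ℝ} (hT : 0 < T)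
    (hper : Function.Periodic p T) (hp : Continuous p) : ∃ K, ∀ t, |p t| ≤ K := by
  obtain ⟨K, hK⟩ := (isCompact_Icc (a := (0 : ℝ)) (b := T)).exists_bound_of_continuousOn
    hp.continuousOn
  refine ⟨K, fun t => ?_⟩
  obtain ⟨s, hs, hst⟩ := hper.exists_mem_Ico₀ hT t
  rw [hst]
  exact hK s (Ico_subset_Icc_self hs)

/-- Total friction drop, per unit mass, over the part of the body whose velocity changes sign as
the velocity of the centre of mass increases from `x` to `x + c`. -/
noncomputable def signChangeDrop (a b M : ℝ) (μp μm w : ℝ → ℝ → ℝ) (c t x : ℝ) : ℝ :=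
  (∫ ξ in Icc a b, if x + w t ξ < 0 ∧ 0 < x + c + w t ξ then μp t ξ + μm t ξ else 0) / M

namespace CrawlerField

variable {T a b M C L : ℝ} {B : ℝ → ℝ} {μp μm : ℝ → ℝ → ℝ} {q : ℝ → ℝ → ℝ → ℝ} {w : ℝ → ℝ → ℝ}

theorem measurable_ite_signChange (h : CrawlerField T a b M C L B μp μm q w) {p : ℝ → ℝ}
    (hp : Measurable p) (c : ℝ) :
    Measurable (Function.uncurry fun t ξ =>
      if p t + w t ξ < 0 ∧ 0 < p t + c + w t ξ then μp t ξ + μm t ξ else 0) := by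
  have h1 : Measurable fun s : ℝ × ℝ => p s.1 + w s.1 s.2 :=
    (hp.comp measurable_fst).add h.measurable_w
  have h2 : Measurable fun s : ℝ × ℝ => p s.1 + c + w s.1 s.2 :=
    ((hp.comp measurable_fst).add_const c).add h.measurable_w
  exact Measurable.ite ((measurableSet_lt h1 measurable_const).inter
    (measurableSet_lt measurable_const h2)) (h.measurable_mup.add h.measurable_mum)
    measurable_const

theorem ite_signChange_nonneg (h : CrawlerField T a b M C L B μp μm q w) (c t x ξ : ℝ) :
    0 ≤ if x + w t ξ < 0 ∧ 0 < x + c + w t ξ then μp t ξ + μm t ξ else 0 := by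
  have h1 := h.mup_nonneg t ξ
  have h2 := h.mum_nonneg t ξ
  split_ifs <;> linarith

theorem abs_ite_signChange_le (h : CrawlerField T a b M C L B μp μm q w) (c t x ξ : ℝ) :
    |if x + w t ξ < 0 ∧ 0 < x + c + w t ξ then μp t ξ + μm t ξ else 0| ≤ C + C := by
  rw [abs_of_nonneg (h.ite_signChange_nonneg c t x ξ)]
  have h1 := h.mup_le t ξ
  have h2 := h.mum_le t ξ
  have h3 := h.force_bound_nonneg
  split_ifs <;> linarith

theorem integrableOn_ite_signChange (h : CrawlerField T a b M C L B μp μm q w) (c t x : ℝ) :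
    IntegrableOn (fun ξ => if x + w t ξ < 0 ∧ 0 < x + c + w t ξ then μp t ξ + μm t ξ else 0)
      (Icc a b) :=
  integrableOn_of_abs_le
    ((h.measurable_ite_signChange (p := fun _ => x) measurable_const c).comp
      (measurable_prodMk_left (x := t))) fun ξ => h.abs_ite_signChange_le c t x ξ

theorem signChangeDrop_nonneg (h : CrawlerField T a b M C L B μp μm q w) (c t x : ℝ) :
    0 ≤ signChangeDrop a b M μp μm w c t x :=
  div_nonneg (integral_nonneg fun ξ => h.ite_signChange_nonneg c t x ξ) h.mass_pos.le

theorem accUp_add_signChangeDrop_le (h : CrawlerField T a b M C L B μp μm q w) {c t x y z : ℝ}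
    (hc : 0 < c) (hx : x ≤ y) (hz : y + c ≤ z) :
    accUp a b M B μp μm q w t z + signChangeDrop a b M μp μm w c t y ≤
      accLo a b M B μp μm q w t x := by
  have hi := h.integrableOn_ite_signChange c t y
  rw [accUp, signChangeDrop, ← add_div, accLo, add_assoc,
    ← integral_add (h.integrableOn_fricUp t z) hi]
  refine div_le_div_of_nonneg_right (add_le_add_right ?_ _) h.mass_pos.le
  refine setIntegral_mono ((h.integrableOn_fricUp t z).add hi) (h.integrableOn_fricLo t x)
    fun ξ => ?_
  simp only
  split_ifs with hs
  · have h1 := h.antitone_q t ξ (show x + w t ξ ≤ z + w t ξ by linarith)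
    have h2 : x + w t ξ < 0 := by linarith [hs.1]
    have h3 : 0 < z + w t ξ := by linarith [hs.2]
    simp only [fricUp, fricLo, h2, h3, if_true]
    linarith
  · rw [add_zero]
    exact h.fricUp_le_fricLo t ξ (by linarith)

theorem signChangeDrop_eq_zero (h : CrawlerField T a b M C L B μp μm q w) {p : ℝ → ℝ}
    (hp : Continuous p) (hper : Function.Periodic p T) {c t₀ m : ℝ} {e E : ℝ → ℝ}
    (he : IsPrimitiveOn e E (Ici t₀)) (hm : ∀ t ∈ Ici t₀, m ≤ e t)
    (hE : ∀ᵐ t ∂(volume : Measure ℝ), t ∈ Ici t₀ →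
      E t ≤ -signChangeDrop a b M μp μm w c t (p t)) :
    ∀ᵐ t ∂(volume : Measure ℝ), signChangeDrop a b M μp μm w c t (p t) = 0 := by
  have hφm : Measurable fun t => signChangeDrop a b M μp μm w c t (p t) :=
    (measurable_setIntegral (h.measurable_ite_signChange hp.measurable c)).div_const M
  have hφb : ∀ t, |signChangeDrop a b M μp μm w c t (p t)| ≤
      (C + C) * volume.real (Icc a b) / M := by
    intro t
    rw [signChangeDrop, abs_div, abs_of_pos h.mass_pos]
    exact div_le_div_of_nonneg_right (abs_setIntegral_le fun ξ =>
      h.abs_ite_signChange_le c t (p t) ξ) h.mass_pos.le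
  have hφper : Function.Periodic (fun t => signChangeDrop a b M μp μm w c t (p t)) T := by
    intro t
    simp only [signChangeDrop, hper t, h.periodic_w, h.periodic_mup, h.periodic_mum]
  have hφi := intervalIntegrable_of_abs_le hφm hφb
  have h1 := he.integral_period_nonneg h.period_pos
    (β := fun t => -signChangeDrop a b M μp μm w c t (p t)) (fun t => congrArg Neg.neg (hφper t))
    (fun s t => (hφi s t).neg) hE hm
  rw [intervalIntegral.integral_neg] at h1
  have h2 : ∫ t in (0 : ℝ)..T, signChangeDrop a b M μp μm w c t (p t) = 0 :=
    le_antisymm (by linarith) (intervalIntegral.integral_nonneg h.period_pos.le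
      fun t _ => h.signChangeDrop_nonneg c t (p t))
  rw [intervalIntegral.integral_eq_zero_iff_of_le_of_nonneg_ae h.period_pos.le
    (ae_of_all _ fun t => h.signChangeDrop_nonneg c t (p t)) (hφi 0 T)] at h2
  refine ae_of_periodic_of_ae_Ioo h.period_pos (Q := fun t =>
    signChangeDrop a b M μp μm w c t (p t) = 0) (fun t => ?_) (a := 0) ?_
  · simp only [hφper t]
  · filter_upwards [(ae_restrict_iff' measurableSet_Ioc).1 h2] with t ht htm
    exact ht ⟨htm.1, by linarith [htm.2]⟩

theorem velocity_nonneg_or_le_neg (h : CrawlerField T a b M C L B μp μm q w) {c t x : ℝ}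
    (hw : ContinuousOn (w t) (Icc a b))
    (hμ : ∀ᵐ ξ ∂(volume : Measure ℝ), ξ ∈ Icc a b → 0 < μp t ξ + μm t ξ)
    (hφ : signChangeDrop a b M μp μm w c t x = 0) :
    ∀ ξ ∈ Icc a b, 0 ≤ x + w t ξ ∨ x + w t ξ ≤ -c := by
  rw [signChangeDrop, div_eq_zero_iff, or_iff_left h.mass_pos.ne',
    integral_eq_zero_iff_of_nonneg (fun ξ => h.ite_signChange_nonneg c t x ξ)
      (h.integrableOn_ite_signChange c t x)] at hφ
  have h1 : (fun ξ => max (min (-(x + w t ξ)) (x + c + w t ξ)) 0) =ᵐ[volume.restrict (Icc a b)]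
      fun _ => 0 := by
    filter_upwards [hφ, ae_restrict_of_ae hμ, ae_restrict_mem measurableSet_Icc] with ξ h2 h3 hξ
    refine max_eq_right (not_lt.1 fun hlt => ?_)
    rw [lt_min_iff, neg_pos] at hlt
    simp only [hlt, and_self, if_true, Pi.zero_apply] at h2
    exact (h3 hξ).ne' h2
  have h2 := Measure.eqOn_Icc_of_ae_eq volume h.lt.ne h1
    (((continuousOn_const.add hw).neg.inf (continuousOn_const.add hw)).sup continuousOn_const)
    continuousOn_const
  intro ξ hξ
  have h3 := max_eq_right_iff.1 (h2 hξ)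
  rcases min_le_iff.1 h3 with h4 | h4
  · exact Or.inl (by linarith)
  · exact Or.inr (by linarith)

/-- Two solutions cannot remain separated by a strip of positive width around a periodic curve. -/
theorem not_separated (h : CrawlerField T a b M C L B μp μm q w)
    (hw : ∀ᵐ t ∂(volume : Measure ℝ), ContinuousOn (w t) (Icc a b) ∧ ∃ ξ ∈ Icc a b, w t ξ = 0)
    (hμ : ∀ᵐ t ∂(volume : Measure ℝ), ∀ᵐ ξ ∂(volume : Measure ℝ),
      ξ ∈ Icc a b → 0 < μp t ξ + μm t ξ)
    (hB : ∫ s in (0 : ℝ)..T, (B s - ∫ ξ in Icc a b, μp s ξ) / M < 0)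
    (hB' : 0 < ∫ s in (0 : ℝ)..T, (B s + ∫ ξ in Icc a b, μm s ξ) / M)
    {p v v' D D' : ℝ → ℝ} {c t₀ : ℝ} (hp : Continuous p) (hper : Function.Periodic p T)
    (hc : 0 < c) (hv : IsPrimitiveOn v D (Ici t₀)) (hv' : IsPrimitiveOn v' D' (Ici t₀))
    (hD : ∀ᵐ t ∂(volume : Measure ℝ), t ∈ Ici t₀ →
      D t ∈ Icc (accLo a b M B μp μm q w t (v t)) (accUp a b M B μp μm q w t (v t)))
    (hD' : ∀ᵐ t ∂(volume : Measure ℝ), t ∈ Ici t₀ →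
      D' t ∈ Icc (accLo a b M B μp μm q w t (v' t)) (accUp a b M B μp μm q w t (v' t)))
    (hpv : ∀ t ∈ Ici t₀, p t + c ≤ v t) (hpv' : ∀ t ∈ Ici t₀, v' t ≤ p t) : False := by
  have hφ := h.signChangeDrop_eq_zero hp hper (c := c) (hv.sub hv') (m := c)
    (fun t ht => by linarith [hpv t ht, hpv' t ht]) (by
      filter_upwards [hD, hD'] with t h1 h2 ht
      linarith [(h1 ht).2, (h2 ht).1,
        h.accUp_add_signChangeDrop_le (t := t) hc (hpv' t ht) (hpv t ht)])
  have hdich : ∀ᵐ t ∂(volume : Measure ℝ), (0 ≤ p t ∨ p t ≤ -c) ∧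
      ((∀ ξ ∈ Icc a b, 0 ≤ p t + w t ξ) ∨ ∀ ξ ∈ Icc a b, p t + w t ξ ≤ -c) := by
    filter_upwards [hφ, hw, hμ] with t h1 h2 h3
    obtain ⟨hwc, ξ, hξ, hξ0⟩ := h2
    have h4 := h.velocity_nonneg_or_le_neg hwc h3 h1
    refine ⟨?_, isPreconnected_Icc.forall_nonneg_or_forall_le_neg (continuousOn_const.add hwc)
      hc h4⟩
    have h5 := h4 ξ hξ
    rwa [hξ0, add_zero] at h5
  have hpd : ∀ t ∈ univ, 0 ≤ p t ∨ p t ≤ -c := by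
    have h1 : (fun t => max (min (-p t) (p t + c)) 0) =ᵐ[volume] fun _ => 0 := by
      filter_upwards [hdich] with t ht
      refine max_eq_right (min_le_iff.2 (ht.1.imp ?_ ?_)) <;> intro <;> linarith
    have h2 := Measure.eq_of_ae_eq h1 ((hp.neg.min (hp.add continuous_const)).max
      continuous_const) continuous_const
    intro t _
    have h3 := max_eq_right_iff.1 (congrFun h2 t)
    refine (min_le_iff.1 h3).imp ?_ ?_ <;> intro <;> linarith
  obtain ⟨K, hK⟩ := hper.exists_abs_le_of_continuous h.period_pos hp
  rcases isPreconnected_univ.forall_nonneg_or_forall_le_neg hp.continuousOn hc hpd with hsgn | hsgn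
  · refine absurd (hv.integral_period_nonneg h.period_pos (fun t => ?_)
      h.intervalIntegrable_lower (m := -K) ?_ ?_) hB.not_ge
    · simp only [h.periodic_force t, h.periodic_mup]
    · filter_upwards [hD, hdich, hw] with t h1 h2 h3 ht
      obtain ⟨-, ξ, hξ, hξ0⟩ := h3
      refine (h1 ht).2.trans (h.accUp_le_of_pos fun η hη => ?_)
      rcases h2.2 with h4 | h4
      · linarith [h4 η hη, hpv t ht]
      · linarith [h4 ξ hξ, hsgn t (mem_univ t)]
    · exact fun t ht => by linarith [(abs_le.1 (hK t)).1, hpv t ht]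
  · have h0 := hv'.neg.integral_period_nonneg h.period_pos
      (β := fun t => -((B t + ∫ ξ in Icc a b, μm t ξ) / M)) (fun t => ?_)
      (fun s t => (h.intervalIntegrable_upper s t).neg) (m := -K) ?_ ?_
    · rw [intervalIntegral.integral_neg] at h0
      linarith
    · simp only [h.periodic_force t, h.periodic_mum]
    · filter_upwards [hD', hdich, hw] with t h1 h2 h3 ht
      obtain ⟨-, ξ, hξ, hξ0⟩ := h3
      refine neg_le_neg (le_trans (h.le_accLo_of_neg fun η hη => ?_) (h1 ht).1)
      rcases h2.2 with h4 | h4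
      · linarith [h4 ξ hξ, hsgn t (mem_univ t)]
      · linarith [h4 η hη, hpv' t ht]
    · exact fun t ht => by linarith [(abs_le.1 (hK t)).2, hpv' t ht]

theorem eventually_sub_lt (h : CrawlerField T a b M C L B μp μm q w)
    {v v' D D' : ℝ → ℝ} {t₀ : ℝ}
    (hv : IsPrimitiveOn v D (Ici t₀)) (hv' : IsPrimitiveOn v' D' (Ici t₀))
    (hD : ∀ᵐ t ∂(volume : Measure ℝ), t ∈ Ici t₀ →
      D t ∈ Icc (accLo a b M B μp μm q w t (v t)) (accUp a b M B μp μm q w t (v t)))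
    (hD' : ∀ᵐ t ∂(volume : Measure ℝ), t ∈ Ici t₀ →
      D' t ∈ Icc (accLo a b M B μp μm q w t (v' t)) (accUp a b M B μp μm q w t (v' t)))
    {ε : ℝ} (hε : 0 < ε) (hne : ¬ ∀ t ∈ Ici t₀, ε ≤ v t - v' t) :
    ∀ᶠ t in atTop, v t - v' t < ε := by
  push Not at hne
  obtain ⟨s, hs, hlt⟩ := hne
  filter_upwards [eventually_ge_atTop s] with t hst
  have h1 := ((hv.sub hv').mono (fun r hr => le_trans hs hr.1 : Icc s t ⊆ Ici t₀)).le_max_zero hst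
    (by
      filter_upwards [hD, hD'] with r h1 h2 hr hpos
      have hr' : r ∈ Ici t₀ := le_trans hs hr.1.le
      linarith [(h1 hr').2, (h2 hr').1, h.accUp_le_accLo r (sub_pos.1 hpos)])
  exact (h1.trans_lt (max_lt hlt hε)).trans_le' le_rfl

theorem tendsto_sub_periodic (h : CrawlerField T a b M C L B μp μm q w)
    (hw : ∀ᵐ t ∂(volume : Measure ℝ), ContinuousOn (w t) (Icc a b) ∧ ∃ ξ ∈ Icc a b, w t ξ = 0)
    (hμ : ∀ᵐ t ∂(volume : Measure ℝ), ∀ᵐ ξ ∂(volume : Measure ℝ),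
      ξ ∈ Icc a b → 0 < μp t ξ + μm t ξ)
    (hB : ∫ s in (0 : ℝ)..T, (B s - ∫ ξ in Icc a b, μp s ξ) / M < 0)
    (hB' : 0 < ∫ s in (0 : ℝ)..T, (B s + ∫ ξ in Icc a b, μm s ξ) / M)
    {p v D P : ℝ → ℝ} {t₀ : ℝ} (hper : Function.Periodic p T)
    (hp : IsPrimitiveOn p P univ) (hv : IsPrimitiveOn v D (Ici t₀))
    (hP : ∀ᵐ t ∂(volume : Measure ℝ),
      P t ∈ Icc (accLo a b M B μp μm q w t (p t)) (accUp a b M B μp μm q w t (p t)))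
    (hD : ∀ᵐ t ∂(volume : Measure ℝ), t ∈ Ici t₀ →
      D t ∈ Icc (accLo a b M B μp μm q w t (v t)) (accUp a b M B μp μm q w t (v t))) :
    Tendsto (fun t => v t - p t) atTop (𝓝 0) := by
  have hp' := hp.mono (subset_univ (Ici t₀))
  have hP' := hP.mono fun t ht (_ : t ∈ Ici t₀) => ht
  rw [Metric.tendsto_nhds]
  intro ε hε
  filter_upwards [h.eventually_sub_lt hv hp' hD hP' hε fun hsep =>
      h.not_separated hw hμ hB hB' hp.continuous hper hε hv hp' hD hP'
        (fun t ht => by linarith [hsep t ht]) fun t _ => le_rfl,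
    h.eventually_sub_lt hp' hv hP' hD hε fun hsep =>
      h.not_separated hw hμ hB hB' (p := fun t => p t - ε) (hp.continuous.sub continuous_const)
        (fun t => by simp only [hper t]) hε hp' hv hP' hD
        (fun t _ => (sub_add_cancel (p t) ε).le) fun t ht => by linarith [hsep t ht]] with t h1 h2
  rw [Real.dist_eq, sub_zero, abs_lt]
  exact ⟨by linarith, h1⟩

end CrawlerField

theorem Function.Periodic.eq_of_tendsto_sub {u v : ℝ → ℝ} {T : ℝ} (hT : 0 < T)
    (hu : Function.Periodic u T) (hv : Function.Periodic v T)
    (h : Tendsto (fun t => u t - v t) atTop (𝓝 0)) : u = v := by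
  ext t
  have h1 : Tendsto (fun n : ℕ => t + n * T) atTop atTop :=
    tendsto_atTop_add_const_left _ _ (tendsto_natCast_atTop_atTop.atTop_mul_const hT)
  have h2 : Tendsto (fun _ : ℕ => u t - v t) atTop (𝓝 0) :=
    (h.comp h1).congr fun n => by
      rw [Function.comp, hu.nat_mul n t, hv.nat_mul n t]
  exact sub_eq_zero.1 (tendsto_nhds_unique tendsto_const_nhds h2)

/-- Continuous crawler model with (C1)–(C4) together with (C6): `q(t,ξ,·)`
monotone decreasing with `q(t,ξ,0) = 0` and the external load dominated by the dry-friction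
coefficients, and (C7): `μ⁺(t,ξ) + μ⁻(t,ξ) > 0` for a.e. `t` and a.e. `ξ ∈ Ω` (the time
derivative `w(t,·)` being continuous on `Ω` for a.e. `t`): the inclusion `v̇ ∈ G(t,v)` admits
exactly one `T`-periodic solution `v*`, which is a global attractor for the dynamics. -/
theorem continuous_crawler_dry (T ξa ξb : ℝ) (hT : 0 < T)
    (ρ : ℝ → ℝ) (M : ℝ) (z w : ℝ → ℝ → ℝ) (B : ℝ → ℝ)
    (μp μm : ℝ → ℝ → ℝ) (q : ℝ → ℝ → ℝ → ℝ)
    (hmodel : ContCrawlerModel T ξa ξb ρ M z w B μp μm q)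
    (hwcont : ∀ᵐ t ∂(volume : Measure ℝ), ContinuousOn (fun ξ => w t ξ) (Set.Icc ξa ξb))
    (hqmono : ∀ t ξ, ∀ u₁ u₂ : ℝ, u₁ ≤ u₂ → q t ξ u₂ ≤ q t ξ u₁)
    (hq0 : ∀ t ξ, q t ξ 0 = 0)
    (hC6int : (∫ s in (0:ℝ)..T, (B s - ∫ ξ in Set.Icc ξa ξb, μp s ξ)) < 0 ∧
      0 < ∫ s in (0:ℝ)..T, (B s + ∫ ξ in Set.Icc ξa ξb, μm s ξ))
    (hC7 : ∀ᵐ t ∂(volume : Measure ℝ), ∀ᵐ ξ ∂(volume : Measure ℝ),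
      ξ ∈ Set.Icc ξa ξb → 0 < μp t ξ + μm t ξ) :
    ∃ vstar : ℝ → ℝ,
      (IsCSolOn (Set.Icc ξa ξb) M B w (fric μp μm q) vstar Set.univ ∧
        Function.Periodic vstar T) ∧
      (∀ u : ℝ → ℝ, IsCSolOn (Set.Icc ξa ξb) M B w (fric μp μm q) u Set.univ →
        Function.Periodic u T → u = vstar) ∧
      ∀ (t₀ : ℝ) (v : ℝ → ℝ),
        IsCSolOn (Set.Icc ξa ξb) M B w (fric μp μm q) v (Set.Ici t₀) →
        Tendsto (fun t => v t - vstar t) atTop (𝓝 0) := by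
  obtain ⟨hab, hρm, hρ, ⟨Cρ, hCρ⟩, hMρ, hM, hzper, ⟨Lt, hzt⟩, ⟨Lξ, hzξ⟩, hz0, hzw, hBm,
    ⟨CB, hCB⟩, hBper, hμpm, hμmm, hμnn, ⟨Cμ, hCμ⟩, hμper, hqlip, hq⟩ := hmodel
  have hρi : IntegrableOn ρ (Icc ξa ξb) :=
    CrawlerField.integrableOn_of_abs_le hρm fun ξ => (abs_of_nonneg (hρ ξ)).trans_le (hCρ ξ)
  obtain ⟨w', hw'm, hw'per, hw'b, hw'⟩ := exists_measurable_velocity hab hρ hρi (hMρ ▸ hM) hzper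
    hzt (fun t => (hzξ t).continuousOn) hz0 hzw hwcont
  have hqabs : ∀ r, ∃ K, ∀ t ξ u, |u| ≤ r → |q t ξ u| ≤ K := by
    intro r
    obtain ⟨K, hK⟩ := hqlip (max r 1) (lt_max_of_lt_right one_pos)
    refine ⟨|K| * r, fun t ξ u hu => ?_⟩
    have h1 := hK t ξ u 0 (hu.trans (le_max_left r 1)) (by simp)
    rw [hq0, sub_zero, sub_zero] at h1
    exact h1.trans (mul_le_mul (le_abs_self K) hu (abs_nonneg u) (abs_nonneg K))
  have hqcont : ∀ t ξ, Continuous (q t ξ) := by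
    intro t ξ
    rw [continuous_iff_continuousAt]
    intro u
    obtain ⟨K, hK⟩ := hqlip (|u| + 1) (by positivity)
    refine tendsto_iff_dist_tendsto_zero.2 (squeeze_zero' (Eventually.of_forall fun _ =>
      dist_nonneg) (g := fun x => K * |x - u|) ?_ ?_)
    · filter_upwards [Metric.ball_mem_nhds u one_pos] with x hx
      rw [Real.dist_eq]
      rw [Metric.mem_ball, Real.dist_eq] at hx
      exact hK t ξ x u (by linarith [abs_sub_abs_le_abs_sub x u]) (by linarith)
    · have h1 : Continuous fun x => K * |x - u| := by fun_prop
      simpa using h1.tendsto u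
  have h : CrawlerField T ξa ξb M (max CB Cμ) Lt B μp μm q w' :=
    { period_pos := hT
      lt := hab
      mass_pos := hM
      measurable_force := hBm
      abs_force_le := fun t => (hCB t).trans (le_max_left _ _)
      periodic_force := hBper
      measurable_mup := hμpm
      measurable_mum := hμmm
      mup_nonneg := fun t ξ => (hμnn t ξ).1
      mum_nonneg := fun t ξ => (hμnn t ξ).2
      mup_le := fun t ξ => (hCμ t ξ).1.trans (le_max_right _ _)
      mum_le := fun t ξ => (hCμ t ξ).2.trans (le_max_right _ _)
      periodic_mup := fun t ξ => (hμper ξ).1 t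
      periodic_mum := fun t ξ => (hμper ξ).2 t
      measurable_q := fun u => (hq u).1
      continuous_q := hqcont
      antitone_q := fun t ξ u₁ u₂ hu => hqmono t ξ u₁ u₂ hu
      q_zero := hq0
      abs_q_le := hqabs
      periodic_q := fun t ξ u => (hq u).2.2 ξ t
      measurable_w := hw'm
      periodic_w := fun t ξ => hw'per ξ t
      abs_w_le := hw'b }
  have hB : ∫ s in (0 : ℝ)..T, (B s - ∫ ξ in Icc ξa ξb, μp s ξ) / M < 0 := by
    rw [intervalIntegral.integral_div]
    exact div_neg_of_neg_of_pos hC6int.1 hM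
  have hB' : 0 < ∫ s in (0 : ℝ)..T, (B s + ∫ ξ in Icc ξa ξb, μm s ξ) / M := by
    rw [intervalIntegral.integral_div]
    exact div_pos hC6int.2 hM
  have hww : ∀ᵐ t ∂(volume : Measure ℝ), ∀ ξ ∈ Icc ξa ξb, w' t ξ = w t ξ :=
    hw'.mono fun t ht => ht.1
  obtain ⟨p, P, hper, hp, hP⟩ := h.exists_periodic hB.le hB'.le
  have hattr : ∀ (t₀ : ℝ) (v : ℝ → ℝ),
      IsCSolOn (Icc ξa ξb) M B w (fric μp μm q) v (Ici t₀) →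
      Tendsto (fun t => v t - p t) atTop (𝓝 0) := by
    intro t₀ v hv
    obtain ⟨D, hvD, hD⟩ := (h.isCSolOn_iff hww).1 hv
    exact h.tendsto_sub_periodic (hw'.mono fun t ht => ht.2) hC7 hB hB' hper hp hvD hP hD
  refine ⟨p, ⟨(h.isCSolOn_iff hww).2 ⟨P, hp, hP.mono fun t ht _ => ht⟩, hper⟩,
    fun u hu huper => ?_, hattr⟩
  obtain ⟨D, hD, hgD⟩ := hu
  exact huper.eq_of_tendsto_sub hT hper (hattr 0 u ⟨D,
    IsPrimitiveOn.mono hD (subset_univ _), hgD.mono fun t ht _ => ht (mem_univ t)⟩)
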